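/- For each of the following pairs of a threshold g_0 and a formula, and for every integer g ≥ g_0, there exists an infinite family F_g of planar digraphs of digirth g such that every H ∈ F_g with n vertices satisfies the formula: (i) g_0 = 6 and fvs(H) = (n − 2)/(g − 3/2); (ii) g_0 = 8 and fvs(H) = (n − 12/5)/(g − 8/5); (iii) g_0 = 9 and fvs(H) = (n − 28/11)/(g − 18/11); (iv) g_0 = 10 and fvs(H) = (n − 8/3)/(g − 5/3); (v) g_0 = 11 and fvs(H) = (n − 36/13)/(g − 22/13). -/

import Mathlib

/-- A finite directed graph. -/
structure Digr where
  V : Type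
  [fintypeV : Fintype V]
  [decEqV : DecidableEq V]
  Adj : V → V → Prop

attribute [instance] Digr.fintypeV Digr.decEqV

/-- `l` is (the list of vertices of) a directed cycle in the digraph `H`. -/
def Digr.IsDicycle (H : Digr) (l : List H.V) : Prop :=
  l ≠ [] ∧ l.Nodup ∧
    ∀ i : Fin l.length,
      H.Adj (l.get i)
        (l.get ⟨(i.1 + 1) % l.length, Nat.mod_lt _ (Nat.lt_of_le_of_lt (Nat.zero_le _) i.isLt)⟩)

/-- A feedback vertex set: a set of vertices meeting every directed cycle. -/
def Digr.IsFVS (H : Digr) (S : Finset H.V) : Prop :=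
  ∀ l : List H.V, H.IsDicycle l → ∃ x ∈ S, x ∈ l

/-- The minimum size of a feedback vertex set of `H`. -/
noncomputable def Digr.fvs (H : Digr) : ℕ :=
  sInf {n | ∃ S : Finset H.V, H.IsFVS S ∧ S.card = n}

/-- `H` has digirth `g`: the minimum length of a directed cycle of `H` is `g`. -/
def Digr.HasDigirth (H : Digr) (g : ℕ) : Prop :=
  (∃ l, H.IsDicycle l ∧ l.length = g) ∧ ∀ l, H.IsDicycle l → g ≤ l.length
/-- A digraph is planar if it can be drawn in the plane: vertices are mapped to
distinct points and every arc to a simple continuous curve between the points of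
its endpoints, such that the interiors of the curves avoid the vertex points and
the curves of distinct arcs have disjoint interiors. -/
def Digr.IsPlanar (H : Digr) : Prop :=
  ∃ (p : H.V → ℝ × ℝ) (arc : ∀ u v : H.V, H.Adj u v → ℝ → ℝ × ℝ),
    Function.Injective p ∧
    (∀ (u v : H.V) (h : H.Adj u v), arc u v h 0 = p u ∧ arc u v h 1 = p v) ∧
    (∀ (u v : H.V) (h : H.Adj u v), ContinuousOn (arc u v h) (Set.Icc 0 1)) ∧
    (∀ (u v : H.V) (h : H.Adj u v), Set.InjOn (arc u v h) (Set.Icc 0 1)) ∧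
    (∀ (u v : H.V) (h : H.Adj u v) (w : H.V),
      ∀ t ∈ Set.Ioo (0 : ℝ) 1, arc u v h t ≠ p w) ∧
    (∀ (u v : H.V) (h : H.Adj u v) (u' v' : H.V) (h' : H.Adj u' v'),
      (u, v) ≠ (u', v') →
      ∀ s ∈ Set.Ioo (0 : ℝ) 1, ∀ t ∈ Set.Ioo (0 : ℝ) 1,
        arc u v h s ≠ arc u' v' h' t)

inductive Kd where
  | top | bot | lf | lb

namespace Kd
def hasUp : Kd → Prop
  | top => True | bot => False | lf => True | lb => True
def hasDn : Kd → Prop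
  | top => False | bot => True | lf => True | lb => True
def isLoop : Kd → Prop
  | top => False | bot => False | lf => True | lb => True
def upL (a b : ℤ) : Kd → ℤ
  | top => min a b | bot => 0 | lf => -(a+b) | lb => -(a+b)
def upR (a b : ℤ) : Kd → ℤ
  | top => max a b | bot => 0 | lf => a | lb => b
def dnL (a b : ℤ) : Kd → ℤ
  | top => 0 | bot => min a b | lf => -(a+b) | lb => -(a+b)
def dnR (a b : ℤ) : Kd → ℤ
  | top => 0 | bot => max a b | lf => b | lb => a
end Kd

/-- Two distinct intervals are disjoint or nested. -/
def NC (l m l' m' : ℤ) : Prop :=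
  (l ≠ l' ∨ m ≠ m') ∧ (m ≤ l' ∨ m' ≤ l ∨ (l ≤ l' ∧ m' ≤ m) ∨ (l' ≤ l ∧ m ≤ m'))

theorem NC.absurd {l m l' m' : ℤ} (h : NC l m l' m') {X : ℝ} (h1 : (l:ℝ) < X) (h2 : X < m)
    (h1' : (l':ℝ) < X) (h2' : X < m') (e : (X - l) * (m - X) = (X - l') * (m' - X)) : False := by
  obtain ⟨hd, hn⟩ := h
  rcases hn with h | h | ⟨ha, hb⟩ | ⟨ha, hb⟩
  · have : (m:ℝ) ≤ l' := by exact_mod_cast h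
    linarith
  · have : (m':ℝ) ≤ l := by exact_mod_cast h
    linarith
  · have ha' : (l:ℝ) ≤ l' := by exact_mod_cast ha
    have hb' : (m':ℝ) ≤ m := by exact_mod_cast hb
    rcases hd with hd | hd
    · have : (l:ℝ) < l' := by exact_mod_cast lt_of_le_of_ne ha hd
      nlinarith
    · have : (m':ℝ) < m := by exact_mod_cast lt_of_le_of_ne hb (Ne.symm hd)
      nlinarith
  · have ha' : (l':ℝ) ≤ l := by exact_mod_cast ha
    have hb' : (m:ℝ) ≤ m' := by exact_mod_cast hb
    rcases hd with hd | hd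
    · have : (l':ℝ) < l := by exact_mod_cast lt_of_le_of_ne ha (Ne.symm hd)
      nlinarith
    · have : (m:ℝ) < m' := by exact_mod_cast lt_of_le_of_ne hb hd
      nlinarith

/-- Loop curve around the left end: from `(a,0)` through the upper half plane to
`(-(a+b),0)` and back through the lower half plane to `(b,0)`. -/
noncomputable def loopC (a b : ℝ) (w : ℝ) : ℝ × ℝ :=
  if w ≤ 1/2 then (a - 2*w*(2*a+b), 2*w*(2*a+b)*((1-2*w)*(2*a+b)))
  else (-(a+b) + (2*w-1)*(a+2*b), -((2*w-1)*(a+2*b)*((2-2*w)*(a+2*b))))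

theorem loopC_cont (a b : ℝ) : Continuous (loopC a b) := by
  unfold loopC
  apply Continuous.if_le
  · fun_prop
  · fun_prop
  · fun_prop
  · fun_prop
  · rintro w rfl
    ext <;> simp <;> ring

theorem loopC_mixed {a b s t : ℝ} (ha : 0 < a) (hb : 0 < b) (hab : a ≠ b)
    (hs0 : 0 ≤ s) (h1 : s ≤ 1/2) (h2 : 1/2 < t) (ht1 : t ≤ 1)
    (hf : a - 2*s*(2*a+b) = -(a+b) + (2*t-1)*(a+2*b))
    (hx : 2*s*(2*a+b)*((1-2*s)*(2*a+b)) = -((2*t-1)*(a+2*b)*((2-2*t)*(a+2*b)))) : False := by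
  have hz1 : 0 < 2*a+b := by positivity
  have hz2 : 0 < a+2*b := by positivity
  have p1 : 0 ≤ 2*s*(2*a+b)*((1-2*s)*(2*a+b)) := by
    apply mul_nonneg
    · positivity
    · apply mul_nonneg <;> linarith
  have hh : 0 ≤ (2-2*t)*(a+2*b) := mul_nonneg (by linarith) hz2.le
  have p2 : 0 < (2*t-1)*(a+2*b) := mul_pos (by linarith) hz2
  have p3 : 0 ≤ (2*t-1)*(a+2*b)*((2-2*t)*(a+2*b)) := mul_nonneg p2.le hh
  have p4 : (2*t-1)*(a+2*b)*((2-2*t)*(a+2*b)) = 0 := by linarith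
  have p5 : 2*s*(2*a+b)*((1-2*s)*(2*a+b)) = 0 := by linarith
  have ht : t = 1 := by
    rcases mul_eq_zero.1 p4 with h | h
    · linarith
    · rcases mul_eq_zero.1 h with h | h <;> linarith
  have hs : s = 0 ∨ s = 1/2 := by
    rcases mul_eq_zero.1 p5 with h | h
    · rcases mul_eq_zero.1 h with h | h
      · left; linarith
      · linarith
    · rcases mul_eq_zero.1 h with h | h
      · right; linarith
      · linarith
  subst ht
  rcases hs with rfl | rfl
  · apply hab; linarith
  · linarith

theorem loopC_inj {a b : ℝ} (ha : 0 < a) (hb : 0 < b) (hab : a ≠ b) :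
    Set.InjOn (loopC a b) (Set.Icc 0 1) := by
  rintro s ⟨hs0, hs1⟩ t ⟨ht0, ht1⟩ h
  have hz1 : 0 < 2*a+b := by positivity
  have hz2 : 0 < a+2*b := by positivity
  unfold loopC at h
  have hf := congrArg Prod.fst h
  have hx := congrArg Prod.snd h
  split_ifs at hf hx with h1 h2 h2
  · simp only at hf
    have h3 : s * (2*a+b) = t * (2*a+b) := by linarith
    exact mul_right_cancel₀ hz1.ne' h3
  · exact (loopC_mixed ha hb hab hs0 h1 (not_le.1 h2) ht1 hf hx).elim
  · exact (loopC_mixed ha hb hab ht0 h2 (not_le.1 h1) hs1 hf.symm hx.symm).elim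
  · simp only at hf
    have h3 : s * (a+2*b) = t * (a+2*b) := by linarith
    exact mul_right_cancel₀ hz2.ne' h3

theorem loopC_int {a b : ℝ} (ha : 0 < a) (hb : 0 < b) {w : ℝ} (h0 : 0 < w) (h1 : w < 1)
    {X Y : ℝ} (h : loopC a b w = (X, Y)) :
    (0 < Y ∧ -(a+b) < X ∧ X < a ∧ Y = (X - -(a+b)) * (a - X)) ∨
    (Y < 0 ∧ -(a+b) < X ∧ X < b ∧ Y = -((X - -(a+b)) * (b - X))) ∨
    (Y = 0 ∧ X = -(a+b)) := by
  have hz1 : 0 < 2*a+b := by positivity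
  have hz2 : 0 < a+2*b := by positivity
  unfold loopC at h
  split_ifs at h with hw
  · simp only [Prod.mk.injEq] at h
    obtain ⟨rfl, rfl⟩ := h
    rcases hw.lt_or_eq with hw | rfl
    · left
      have q1 : 0 < 2*w*(2*a+b) := by positivity
      have q2 : 0 < (1-2*w)*(2*a+b) := mul_pos (by linarith) hz1
      refine ⟨mul_pos q1 q2, by nlinarith, by linarith, by ring⟩
    · right; right
      constructor <;> ring
  · simp only [Prod.mk.injEq] at h
    obtain ⟨rfl, rfl⟩ := h
    right; left
    have q1 : 0 < (2*w-1)*(a+2*b) := mul_pos (by linarith) hz2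
    have q2 : 0 < (2-2*w)*(a+2*b) := mul_pos (by linarith) hz2
    refine ⟨by have := mul_pos q1 q2; linarith, by linarith, by nlinarith, by ring⟩

/-- The curve of each kind. -/
noncomputable def crv (a b : ℝ) : Kd → ℝ → ℝ × ℝ
  | .top => fun w => (a + (b-a)*w, w*(1-w)*(b-a)^2)
  | .bot => fun w => (a + (b-a)*w, -(w*(1-w)*(b-a)^2))
  | .lf => loopC a b
  | .lb => fun w => loopC b a (1-w)

theorem crv_ends (a b : ℝ) (k : Kd) : crv a b k 0 = (a, 0) ∧ crv a b k 1 = (b, 0) := by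
  cases k <;> simp [crv, loopC] <;> norm_num <;> ring

theorem crv_cont (a b : ℝ) (k : Kd) : Continuous (crv a b k) := by
  cases k
  · unfold crv; fun_prop
  · unfold crv; fun_prop
  · exact loopC_cont a b
  · exact (loopC_cont b a).comp (by fun_prop)

theorem crv_inj {a b : ℝ} (ha : 0 < a) (hb : 0 < b) (hab : a ≠ b) (k : Kd) :
    Set.InjOn (crv a b k) (Set.Icc 0 1) := by
  have hba : b - a ≠ 0 := sub_ne_zero.2 hab.symm
  cases k
  · intro s _ t _ h
    have := congrArg Prod.fst h
    simp only [crv] at this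
    exact mul_left_cancel₀ hba (by linarith)
  · intro s _ t _ h
    have := congrArg Prod.fst h
    simp only [crv] at this
    exact mul_left_cancel₀ hba (by linarith)
  · exact loopC_inj ha hb hab
  · intro s hs t ht h
    have := loopC_inj hb ha hab.symm (x₁ := 1-s) (x₂ := 1-t)
      ⟨by linarith [hs.2], by linarith [hs.1]⟩ ⟨by linarith [ht.2], by linarith [ht.1]⟩ h
    linarith

theorem par_int {a b w : ℝ} (hab : a ≠ b) (h0 : 0 < w) (h1 : w < 1) :
    min a b < a + (b-a)*w ∧ a + (b-a)*w < max a b ∧ 0 < w*(1-w)*(b-a)^2 ∧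
    w*(1-w)*(b-a)^2 = (a + (b-a)*w - min a b) * (max a b - (a + (b-a)*w)) := by
  have hpos : 0 < w*(1-w)*(b-a)^2 := by
    have : b - a ≠ 0 := sub_ne_zero.2 hab.symm
    have : 0 < 1 - w := by linarith
    positivity
  rcases lt_or_gt_of_ne hab with h | h
  · rw [min_eq_left h.le, max_eq_right h.le]
    refine ⟨by nlinarith, by nlinarith, hpos, by ring⟩
  · rw [min_eq_right h.le, max_eq_left h.le]
    refine ⟨by nlinarith, by nlinarith, hpos, by ring⟩

theorem crv_int {a b : ℤ} (ha : 0 < a) (hb : 0 < b) (hab : a ≠ b) (k : Kd) {w : ℝ}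
    (h0 : 0 < w) (h1 : w < 1) {X Y : ℝ} (h : crv a b k w = (X, Y)) :
    (0 < Y ∧ k.hasUp ∧ (k.upL a b : ℝ) < X ∧ X < k.upR a b ∧
      Y = (X - k.upL a b) * (k.upR a b - X)) ∨
    (Y < 0 ∧ k.hasDn ∧ (k.dnL a b : ℝ) < X ∧ X < k.dnR a b ∧
      Y = -((X - k.dnL a b) * (k.dnR a b - X))) ∨
    (Y = 0 ∧ k.isLoop ∧ X = -(a+b)) := by
  have ha' : (0:ℝ) < a := by exact_mod_cast ha
  have hb' : (0:ℝ) < b := by exact_mod_cast hb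
  have hab' : (a:ℝ) ≠ b := by exact_mod_cast hab
  cases k
  · simp only [crv, Prod.mk.injEq] at h
    obtain ⟨rfl, rfl⟩ := h
    obtain ⟨q1, q2, q3, q4⟩ := par_int hab' h0 h1
    left
    refine ⟨q3, trivial, ?_, ?_, ?_⟩ <;> simp only [Kd.upL, Kd.upR, Int.cast_min, Int.cast_max]
    exacts [q1, q2, q4]
  · simp only [crv, Prod.mk.injEq] at h
    obtain ⟨rfl, rfl⟩ := h
    obtain ⟨q1, q2, q3, q4⟩ := par_int hab' h0 h1
    right; left
    refine ⟨by linarith, trivial, ?_, ?_, ?_⟩ <;>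
      simp only [Kd.dnL, Kd.dnR, Int.cast_min, Int.cast_max]
    exacts [q1, q2, by rw [q4]]
  · rcases loopC_int ha' hb' h0 h1 h with q | q | q
    · left
      simp only [Kd.upL, Kd.upR]; push_cast
      exact ⟨q.1, trivial, q.2⟩
    · right; left
      simp only [Kd.dnL, Kd.dnR]; push_cast
      exact ⟨q.1, trivial, q.2⟩
    · right; right
      exact ⟨q.1, trivial, q.2⟩
  · rcases loopC_int hb' ha' (w := 1 - w) (by linarith) (by linarith) h with q | q | q
    · left
      simp only [Kd.upL, Kd.upR]; push_cast
      rw [add_comm] at q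
      exact ⟨q.1, trivial, q.2⟩
    · right; left
      simp only [Kd.dnL, Kd.dnR]; push_cast
      rw [add_comm] at q
      exact ⟨q.1, trivial, q.2⟩
    · right; right
      rw [add_comm] at q
      exact ⟨q.1, trivial, q.2⟩

theorem planar_of (H : Digr) (pos : H.V → ℤ) (k : H.V → H.V → Kd)
    (hpos : ∀ v, 0 < pos v) (hinj : Function.Injective pos)
    (hne : ∀ u v, H.Adj u v → u ≠ v)
    (hup : ∀ u v u' v', H.Adj u v → H.Adj u' v' → (u, v) ≠ (u', v') →
      (k u v).hasUp → (k u' v').hasUp →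
      NC ((k u v).upL (pos u) (pos v)) ((k u v).upR (pos u) (pos v))
        ((k u' v').upL (pos u') (pos v')) ((k u' v').upR (pos u') (pos v')))
    (hdn : ∀ u v u' v', H.Adj u v → H.Adj u' v' → (u, v) ≠ (u', v') →
      (k u v).hasDn → (k u' v').hasDn →
      NC ((k u v).dnL (pos u) (pos v)) ((k u v).dnR (pos u) (pos v))
        ((k u' v').dnL (pos u') (pos v')) ((k u' v').dnR (pos u') (pos v')))
    (hloop : ∀ u v u' v', H.Adj u v → H.Adj u' v' → (u, v) ≠ (u', v') →
      (k u v).isLoop → (k u' v').isLoop → pos u + pos v ≠ pos u' + pos v') :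
    H.IsPlanar := by
  refine ⟨fun v => ((pos v : ℝ), 0), fun u v _ => crv (pos u) (pos v) (k u v), ?_, ?_, ?_, ?_,
    ?_, ?_⟩
  · intro u v h
    have := congrArg Prod.fst h
    simp only at this
    exact hinj (by exact_mod_cast this)
  · intro u v h
    exact crv_ends _ _ _
  · intro u v h
    exact (crv_cont _ _ _).continuousOn
  · intro u v h
    apply crv_inj
    · exact_mod_cast hpos u
    · exact_mod_cast hpos v
    · exact_mod_cast hinj.ne (hne u v h)
  · intro u v h w t ht e
    have p1 : (0:ℝ) < pos u := by exact_mod_cast hpos u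
    have p2 : (0:ℝ) < pos v := by exact_mod_cast hpos v
    have p3 : (0:ℝ) < pos w := by exact_mod_cast hpos w
    rcases crv_int (hpos u) (hpos v) (hinj.ne (hne u v h)) (k u v) ht.1 ht.2 e with q | q | q
    · exact lt_irrefl _ q.1
    · exact lt_irrefl _ q.1
    · have := q.2.2
      linarith
  · intro u v h u' v' h' hd s hs t ht e
    obtain ⟨X, Y, hXY⟩ : ∃ X Y, crv (pos u) (pos v) (k u v) s = (X, Y) := ⟨_, _, rfl⟩
    have hXY' : crv (pos u') (pos v') (k u' v') t = (X, Y) := Eq.trans e.symm hXY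
    rcases crv_int (hpos u) (hpos v) (hinj.ne (hne u v h)) (k u v) hs.1 hs.2 hXY with q | q | q <;>
    rcases crv_int (hpos u') (hpos v') (hinj.ne (hne u' v' h')) (k u' v') ht.1 ht.2 hXY'
      with q' | q' | q'
    · exact (hup u v u' v' h h' hd q.2.1 q'.2.1).absurd q.2.2.1 q.2.2.2.1 q'.2.2.1 q'.2.2.2.1
        (by rw [← q.2.2.2.2, ← q'.2.2.2.2])
    · linarith [q.1, q'.1]
    · linarith [q.1, q'.1]
    · linarith [q.1, q'.1]
    · exact (hdn u v u' v' h h' hd q.2.1 q'.2.1).absurd q.2.2.1 q.2.2.2.1 q'.2.2.1 q'.2.2.2.1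
        (neg_injective (by rw [← q.2.2.2.2, ← q'.2.2.2.2]))
    · linarith [q.1, q'.1]
    · linarith [q.1, q'.1]
    · linarith [q.1, q'.1]
    · apply hloop u v u' v' h h' hd q.2.1 q'.2.1
      have h1 := q.2.2
      have h2 := q'.2.2
      have : (pos u : ℝ) + pos v = pos u' + pos v' := by linarith
      exact_mod_cast this

theorem exists_dicycle (H : Digr) (U : Set H.V) (hne : U.Nonempty)
    (h : ∀ u ∈ U, ∃ v ∈ U, H.Adj u v) : ∃ l, H.IsDicycle l ∧ ∀ x ∈ l, x ∈ U := by
  classical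
  choose! nx hnx using h
  obtain ⟨u0, hu0⟩ := hne
  have hit : ∀ k, nx^[k] u0 ∈ U := by
    intro k
    induction k with
    | zero => exact hu0
    | succ k ih => rw [Function.iterate_succ_apply']; exact (hnx _ ih).1
  obtain ⟨i, j, hij, he⟩ := Finite.exists_ne_map_eq_of_infinite (fun k : ℕ => nx^[k] u0)
  wlog hlt : i < j generalizing i j
  · exact this j i hij.symm he.symm (lt_of_le_of_ne (not_lt.1 hlt) hij.symm)
  set y := nx^[i] u0 with hy
  have hper : Function.IsPeriodicPt nx (j - i) y := by
    unfold Function.IsPeriodicPt Function.IsFixedPt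
    rw [hy, ← Function.iterate_add_apply, Nat.sub_add_cancel hlt.le, ← he]
  have hU : ∀ k, nx^[k] y ∈ U := by
    intro k
    rw [hy, ← Function.iterate_add_apply]; exact hit _
  set n := Function.minimalPeriod nx y with hn
  have hnpos : 0 < n := hper.minimalPeriod_pos (by omega)
  have hm : ∀ k : ℕ, nx^[(k + 1) % n] y = nx (nx^[k] y) := by
    intro k
    rw [hn, Function.iterate_mod_minimalPeriod_eq, Function.iterate_succ_apply']
  refine ⟨(List.range n).map (fun k => nx^[k] y), ⟨?_, ?_, ?_⟩, ?_⟩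
  · simp; omega
  · refine List.Nodup.map_on ?_ List.nodup_range
    intro a ha b hb hab
    exact Function.iterate_injOn_Iio_minimalPeriod (by simpa using ha) (by simpa using hb) hab
  · intro k
    simp only [List.get_eq_getElem, List.getElem_map, List.getElem_range, List.length_map,
      List.length_range]
    rw [hm]
    exact (hnx _ (hU _)).2
  · intro x hx
    simp only [List.mem_map] at hx
    obtain ⟨k, -, rfl⟩ := hx
    exact hU k

theorem Digr.IsDicycle.closed {H : Digr} {l : List H.V} (h : H.IsDicycle l) :
    l.toFinset.Nonempty ∧ l.toFinset.card = l.length ∧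
    (∀ u ∈ l.toFinset, ∃ v ∈ l.toFinset, H.Adj u v) ∧
    (∀ u ∈ l.toFinset, ∃ v ∈ l.toFinset, H.Adj v u) := by
  obtain ⟨h1, h2, h3⟩ := h
  refine ⟨by simpa using h1, List.toFinset_card_of_nodup h2, ?_, ?_⟩
  · intro u hu
    rw [List.mem_toFinset] at hu
    obtain ⟨i, rfl⟩ := List.mem_iff_get.1 hu
    exact ⟨_, by rw [List.mem_toFinset]; exact List.get_mem _ _, h3 i⟩
  · intro u hu
    rw [List.mem_toFinset] at hu
    obtain ⟨i, rfl⟩ := List.mem_iff_get.1 hu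
    have hp : 0 < l.length := by have := i.2; omega
    have hlt : (i.1 + (l.length - 1)) % l.length < l.length := Nat.mod_lt _ hp
    refine ⟨l.get ⟨_, hlt⟩, by rw [List.mem_toFinset]; exact List.get_mem _ _, ?_⟩
    have := h3 ⟨_, hlt⟩
    convert this using 2
    ext
    simp only
    rw [Nat.mod_add_mod]
    have : i.1 + (l.length - 1) + 1 = i.1 + l.length := by omega
    rw [this, Nat.add_mod_right, Nat.mod_eq_of_lt i.2]

section Tau
variable {α : Type} [DecidableEq α]

/-- The successor map modified by the transpositions given by a list of touches. -/
def tau (nx m1 m2 : α → α) : List α → α → α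
  | [] => nx
  | k :: L => fun u => tau nx m1 m2 L (Equiv.swap (m1 k) (m2 k) u)

theorem orbit_swap (t : α → α) (a b : α) (G : Set α) (ha : a ∈ G) (Y : Finset α)
    (h : ∀ u ∈ G, ∃ k, (fun u => t (Equiv.swap a b u))^[k] u ∈ Y) :
    (∀ u ∈ G, ∃ k, t^[k] u ∈ insert a Y) ∨ (∀ u ∈ G, ∃ k, t^[k] u ∈ insert b Y) := by
  by_contra hcon
  push Not at hcon
  obtain ⟨⟨u, hu, h1⟩, ⟨u', hu', h2⟩⟩ := hcon
  set s := (fun u => t (Equiv.swap a b u)) with hs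
  have key : ∀ v ∈ G, (∀ k, t^[k] v ∉ Y) → (∃ k, t^[k] v = a) ∨ (∃ k, t^[k] v = b) := by
    intro v hv hY
    by_contra hc
    push Not at hc
    obtain ⟨k, hk⟩ := h v hv
    have : ∀ k, s^[k] v = t^[k] v := by
      intro k
      induction k with
      | zero => rfl
      | succ k ih =>
        rw [Function.iterate_succ_apply', Function.iterate_succ_apply', ih, hs]
        simp only
        rw [Equiv.swap_apply_of_ne_of_ne (hc.1 k) (hc.2 k)]
    rw [this] at hk
    exact hY k hk
  have hb : ∃ k, t^[k] u = b := by
    rcases key u hu (fun k hk => h1 k (Finset.mem_insert_of_mem hk)) with ⟨k, hk⟩ | h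
    · exact (h1 k (by rw [hk]; exact Finset.mem_insert_self _ _)).elim
    · exact h
  have ha' : ∃ k, t^[k] u' = a := by
    rcases key u' hu' (fun k hk => h2 k (Finset.mem_insert_of_mem hk)) with h | ⟨k, hk⟩
    · exact h
    · exact (h2 k (by rw [hk]; exact Finset.mem_insert_self _ _)).elim
  obtain ⟨kb, hkb⟩ := hb
  obtain ⟨ka, hka⟩ := ha'
  have hbY : ∀ k, t^[k] b ∉ Y := by
    intro k hk
    rw [← hkb, ← Function.iterate_add_apply] at hk
    exact h1 _ (Finset.mem_insert_of_mem hk)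
  have haY : ∀ k, t^[k] a ∉ Y := by
    intro k hk
    rw [← hka, ← Function.iterate_add_apply] at hk
    exact h2 _ (Finset.mem_insert_of_mem hk)
  have hO : ∀ k, (∃ j, s^[k] a = t^[j] a) ∨ (∃ j, s^[k] a = t^[j] b) := by
    intro k
    induction k with
    | zero => exact Or.inl ⟨0, rfl⟩
    | succ k ih =>
      rw [Function.iterate_succ_apply']
      by_cases e1 : s^[k] a = a
      · right
        refine ⟨1, ?_⟩
        rw [e1, hs]; simp
      by_cases e2 : s^[k] a = b
      · left
        refine ⟨1, ?_⟩
        rw [e2, hs]; simp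
      have e3 : s (s^[k] a) = t (s^[k] a) := by
        rw [hs]; simp only
        rw [Equiv.swap_apply_of_ne_of_ne e1 e2]
      rw [e3]
      rcases ih with ⟨j, hj⟩ | ⟨j, hj⟩
      · left; exact ⟨j+1, by rw [hj, Function.iterate_succ_apply']⟩
      · right; exact ⟨j+1, by rw [hj, Function.iterate_succ_apply']⟩
  obtain ⟨k, hk⟩ := h a ha
  rcases hO k with ⟨j, hj⟩ | ⟨j, hj⟩
  · rw [hj] at hk; exact haY j hk
  · rw [hj] at hk; exact hbY j hk

theorem tau_hit (nx m1 m2 : α → α) (G : Set α) (L : List α) (hL : ∀ k ∈ L, m1 k ∈ G) :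
    ∀ Y : Finset α, (∀ u ∈ G, ∃ k, (tau nx m1 m2 L)^[k] u ∈ Y) →
    ∃ Y' : Finset α, Y'.card ≤ Y.card + L.length ∧ ∀ u ∈ G, ∃ k, nx^[k] u ∈ Y' := by
  induction L with
  | nil => intro Y h; exact ⟨Y, by simp, h⟩
  | cons c L ih =>
    intro Y h
    rcases orbit_swap (tau nx m1 m2 L) (m1 c) (m2 c) G (hL c (by simp)) Y h with h' | h'
    · obtain ⟨Y', h1, h2⟩ := ih (fun k hk => hL k (List.mem_cons_of_mem _ hk)) _ h'
      refine ⟨Y', ?_, h2⟩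
      have := Finset.card_insert_le (m1 c) Y
      simp only [List.length_cons]; omega
    · obtain ⟨Y', h1, h2⟩ := ih (fun k hk => hL k (List.mem_cons_of_mem _ hk)) _ h'
      refine ⟨Y', ?_, h2⟩
      have := Finset.card_insert_le (m2 c) Y
      simp only [List.length_cons]; omega

theorem tau_val (nx m1 m2 : α → α) (T : Set α)
    (h1 : ∀ k ∈ T, ∀ k' ∈ T, m1 k = m1 k' → k = k')
    (h2 : ∀ k ∈ T, ∀ k' ∈ T, m2 k = m2 k' → k = k')
    (h3 : ∀ k ∈ T, ∀ k' ∈ T, m1 k ≠ m2 k')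
    (L : List α) (hL : ∀ k ∈ L, k ∈ T) (hn : L.Nodup) :
    (∀ u, (∀ k ∈ L, m1 k ≠ u ∧ m2 k ≠ u) → tau nx m1 m2 L u = nx u) ∧
    (∀ k ∈ L, tau nx m1 m2 L (m1 k) = nx (m2 k) ∧ tau nx m1 m2 L (m2 k) = nx (m1 k)) := by
  induction L with
  | nil => exact ⟨fun u _ => rfl, fun k hk => by simp at hk⟩
  | cons c L ih =>
    rw [List.nodup_cons] at hn
    have hc : c ∈ T := hL c (by simp)
    have hL' : ∀ k ∈ L, k ∈ T := fun k hk => hL k (List.mem_cons_of_mem _ hk)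
    obtain ⟨i1, i2⟩ := ih hL' hn.2
    refine ⟨?_, ?_⟩
    · intro u hu
      have := hu c (by simp)
      simp only [tau]
      rw [Equiv.swap_apply_of_ne_of_ne this.1.symm this.2.symm]
      exact i1 u (fun k hk => hu k (List.mem_cons_of_mem _ hk))
    · intro k hk
      rw [List.mem_cons] at hk
      rcases hk with rfl | hk
      · simp only [tau, Equiv.swap_apply_left, Equiv.swap_apply_right]
        refine ⟨i1 _ ?_, i1 _ ?_⟩
        · intro k' hk'
          refine ⟨h3 k' (hL' k' hk') k hc, fun e => hn.1 ?_⟩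
          rw [← h2 k' (hL' k' hk') k hc e]; exact hk'
        · intro k' hk'
          refine ⟨fun e => hn.1 ?_, (h3 k hc k' (hL' k' hk')).symm⟩
          rw [← h1 k' (hL' k' hk') k hc e]; exact hk'
      · have hne : k ≠ c := by rintro rfl; exact hn.1 hk
        have hkT := hL' k hk
        simp only [tau]
        rw [Equiv.swap_apply_of_ne_of_ne (fun e => hne (h1 k hkT c hc e)) (h3 k hkT c hc),
          Equiv.swap_apply_of_ne_of_ne (h3 c hc k hkT).symm (fun e => hne (h2 k hkT c hc e))]
        exact i2 k hk
end Tau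

/-- Raw vertices: ordinary vertices `N i j` and touch vertices `C i`, `D i`. -/
inductive Vx where
  | N (i j : ℕ) | C (i : ℕ) | D (i : ℕ)
  deriving DecidableEq

/-- Parameters of the construction. -/
structure Par where
  f : ℕ
  g : ℕ
  x : ℕ → ℕ
  y : ℕ → ℕ
  p : ℕ → ℕ
  r : ℕ → ℕ
  a : ℕ → ℕ
  hf : 4 ≤ f
  hx : ∀ i, i < f → 1 ≤ x i
  hy : ∀ i, i < f → 1 ≤ y i
  ha1 : ∀ i, a i ≤ 1
  ha : ∀ i, a i = 1 → i + 3 < f ∧ 1 ≤ p i ∧ p i < x i ∧ 1 ≤ r (i+3) ∧ r (i+3) < y (i+3)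
  hdeg : ∀ i, i < f → x i + y i + (if i + 1 < f then 1 else 0) + (if 0 < i then 1 else 0)
    + a i + (if 3 ≤ i then a (i-3) else 0) = g

namespace Par
open Vx
variable (P : Par)

def Valid : Vx → Prop
  | N i j => i < P.f ∧ j < P.x i + P.y i
  | C i => i + 1 < P.f
  | D i => P.a i = 1

def isT : Vx → Prop
  | N _ _ => False
  | C _ => True
  | D _ => True

def T (v : Vx) : Prop := isT v ∧ P.Valid v

def nx : Vx → Vx
  | N i j => if j + 1 = P.x i + P.y i then N i 0 else N i (j+1)
  | C i => C i
  | D i => D i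

def m1 : Vx → Vx
  | N i j => N i j
  | C i => N i (P.x i + P.y i - 1)
  | D i => N i (P.p i - 1)

def m2 : Vx → Vx
  | N i j => N i j
  | C i => N (i+1) (P.x (i+1) - 1)
  | D i => N (i+3) (P.x (i+3) + P.r (i+3) - 1)

inductive Arc : Vx → Vx → Prop
  | pl (u : Vx) : ¬ isT u → P.Valid u → (∀ c, P.T c → P.m1 c ≠ u ∧ P.m2 c ≠ u) → Arc u (P.nx u)
  | i1 (c : Vx) : P.T c → Arc (P.m1 c) c
  | i2 (c : Vx) : P.T c → Arc (P.m2 c) c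
  | o1 (c : Vx) : P.T c → Arc c (P.nx (P.m1 c))
  | o2 (c : Vx) : P.T c → Arc c (P.nx (P.m2 c))
  | s1 (c : Vx) : P.T c → Arc (P.m1 c) (P.nx (P.m2 c))
  | s2 (c : Vx) : P.T c → Arc (P.m2 c) (P.nx (P.m1 c))

/-- The set of vertices. -/
def vs : Finset Vx :=
  ((Finset.range P.f).sigma (fun i => Finset.range (P.x i + P.y i))).image
      (fun q : (_ : ℕ) × ℕ => N q.1 q.2) ∪
    ((Finset.range (P.f - 1)).image C ∪
    ((Finset.range P.f).filter (fun i => P.a i = 1)).image D)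

theorem mem_vs (v : Vx) : v ∈ P.vs ↔ P.Valid v := by
  cases v with
  | N i j =>
    simp only [vs, Valid, Finset.mem_union, Finset.mem_image, Finset.mem_sigma, Finset.mem_range]
    constructor
    · rintro (⟨⟨a, b⟩, h, e⟩ | ⟨a, _, e⟩ | ⟨a, _, e⟩)
      · simp only [N.injEq] at e
        obtain ⟨rfl, rfl⟩ := e
        exact h
      · cases e
      · cases e
    · intro h
      exact Or.inl ⟨⟨i, j⟩, h, rfl⟩
  | C i =>
    simp [vs, Valid]; omega
  | D i =>
    simp [vs, Valid]
    intro h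
    have := P.ha i h
    omega

theorem card_vs : P.vs.card = (∑ i ∈ Finset.range P.f, (P.x i + P.y i)) + (P.f - 1) +
    ((Finset.range P.f).filter (fun i => P.a i = 1)).card := by
  unfold vs
  rw [Finset.card_union_of_disjoint, Finset.card_union_of_disjoint, Finset.card_image_of_injective,
    Finset.card_image_of_injective, Finset.card_image_of_injective, Finset.card_sigma]
  · simp [add_assoc]
  · intro a b h; simpa using h
  · intro a b h; simpa using h
  · rintro ⟨a, b⟩ ⟨c, d⟩ h
    simp only [N.injEq] at h
    obtain ⟨rfl, rfl⟩ := h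
    rfl
  · rw [Finset.disjoint_left]
    intro v hv hv'
    simp only [Finset.mem_image] at hv hv'
    obtain ⟨_, _, rfl⟩ := hv
    obtain ⟨_, _, h⟩ := hv'
    cases h
  · rw [Finset.disjoint_left]
    intro v hv hv'
    simp only [Finset.mem_image, Finset.mem_union] at hv hv'
    obtain ⟨_, _, rfl⟩ := hv
    rcases hv' with ⟨_, _, h⟩ | ⟨_, _, h⟩ <;> cases h

def H : Digr where
  V := {v : Vx // v ∈ P.vs}
  Adj u v := P.Arc u.1 v.1

theorem valid_nx (u : Vx) (h : P.Valid u) : P.Valid (P.nx u) := by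
  cases u with
  | N i j =>
    simp only [nx]
    split_ifs with h1 <;> simp only [Valid] at h ⊢ <;> omega
  | C i => exact h
  | D i => exact h

theorem isT_nx (u : Vx) (h : ¬ isT u) : ¬ isT (P.nx u) := by
  cases u with
  | N i j =>
    simp only [nx]
    split_ifs with h1 <;> simp [isT]
  | C i => exact h
  | D i => exact h

theorem m1_ok (c : Vx) (h : P.T c) : ¬ isT (P.m1 c) ∧ P.Valid (P.m1 c) := by
  obtain ⟨h1, h2⟩ := h
  cases c with
  | N i j => exact h1.elim
  | C i =>
    simp only [Valid] at h2
    have := P.hx i (by omega)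
    simp only [isT, m1, Valid]
    exact ⟨fun h => h, by omega, by omega⟩
  | D i =>
    simp only [Valid] at h2
    have := P.ha i h2
    simp only [isT, m1, Valid]
    exact ⟨fun h => h, by omega, by omega⟩

theorem m2_ok (c : Vx) (h : P.T c) : ¬ isT (P.m2 c) ∧ P.Valid (P.m2 c) := by
  obtain ⟨h1, h2⟩ := h
  cases c with
  | N i j => exact h1.elim
  | C i =>
    simp only [Valid] at h2
    have := P.hx (i+1) (by omega)
    simp only [isT, m2, Valid]
    exact ⟨fun h => h, by omega, by omega⟩
  | D i =>
    simp only [Valid] at h2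
    have := P.ha i h2
    simp only [isT, m2, Valid]
    exact ⟨fun h => h, by omega, by omega⟩

theorem m1_inj (c : Vx) (h : P.T c) (c' : Vx) (h' : P.T c') (e : P.m1 c = P.m1 c') : c = c' := by
  cases c with
  | N i j => exact h.1.elim
  | C i =>
    cases c' with
    | N i j => exact h'.1.elim
    | C i' => simp only [m1, N.injEq] at e; rw [e.1]
    | D i' =>
      simp only [m1, N.injEq] at e
      obtain ⟨rfl, e⟩ := e
      have := P.ha i h'.2
      have := P.hy i (by omega)
      omega
  | D i =>
    cases c' with
    | N i j => exact h'.1.elim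
    | C i' =>
      simp only [m1, N.injEq] at e
      obtain ⟨rfl, e⟩ := e
      have := P.ha i h.2
      have := P.hy i (by omega)
      omega
    | D i' => simp only [m1, N.injEq] at e; rw [e.1]

theorem m2_inj (c : Vx) (h : P.T c) (c' : Vx) (h' : P.T c') (e : P.m2 c = P.m2 c') : c = c' := by
  cases c with
  | N i j => exact h.1.elim
  | C i =>
    cases c' with
    | N i j => exact h'.1.elim
    | C i' => simp only [m2, N.injEq] at e; rw [show i = i' by omega]
    | D i' =>
      simp only [m2, N.injEq] at e
      obtain ⟨e1, e⟩ := e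
      have := P.ha i' h'.2
      obtain rfl : i = i' + 2 := by omega
      have := P.hx (i'+3) (by omega)
      simp only [show i' + 2 + 1 = i' + 3 from rfl] at e
      omega
  | D i =>
    cases c' with
    | N i j => exact h'.1.elim
    | C i' =>
      simp only [m2, N.injEq] at e
      obtain ⟨e1, e⟩ := e
      have := P.ha i h.2
      obtain rfl : i' = i + 2 := by omega
      have := P.hx (i+3) (by omega)
      simp only [show i + 2 + 1 = i + 3 from rfl] at e
      omega
    | D i' => simp only [m2, N.injEq] at e; rw [show i = i' by omega]

theorem m12_ne (c : Vx) (h : P.T c) (c' : Vx) (h' : P.T c') : P.m1 c ≠ P.m2 c' := by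
  intro e
  cases c with
  | N i j => exact h.1.elim
  | C i =>
    have h2 : i + 1 < P.f := h.2
    cases c' with
    | N i j => exact h'.1.elim
    | C i' =>
      simp only [m1, m2, N.injEq] at e
      obtain ⟨rfl, e⟩ := e
      have := P.hx (i'+1) (by omega)
      have := P.hy (i'+1) (by omega)
      omega
    | D i' =>
      simp only [m1, m2, N.injEq] at e
      obtain ⟨rfl, e⟩ := e
      have := P.ha i' h'.2
      omega
  | D i =>
    have h2 := P.ha i h.2
    cases c' with
    | N i j => exact h'.1.elim
    | C i' =>
      simp only [m1, m2, N.injEq] at e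
      obtain ⟨rfl, e⟩ := e
      omega
    | D i' =>
      simp only [m1, m2, N.injEq] at e
      obtain ⟨rfl, e⟩ := e
      have := P.ha i' h'.2
      omega

theorem arc_valid {u v : Vx} (h : P.Arc u v) : P.Valid u ∧ P.Valid v := by
  cases h with
  | pl u h1 h2 h3 => exact ⟨h2, P.valid_nx _ h2⟩
  | i1 c h => exact ⟨(P.m1_ok _ h).2, h.2⟩
  | i2 c h => exact ⟨(P.m2_ok _ h).2, h.2⟩
  | o1 c h => exact ⟨h.2, P.valid_nx _ (P.m1_ok _ h).2⟩
  | o2 c h => exact ⟨h.2, P.valid_nx _ (P.m2_ok _ h).2⟩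
  | s1 c h => exact ⟨(P.m1_ok _ h).2, P.valid_nx _ (P.m2_ok _ h).2⟩
  | s2 c h => exact ⟨(P.m2_ok _ h).2, P.valid_nx _ (P.m1_ok _ h).2⟩

def idx : Vx → ℕ
  | N i _ => i | C i => i | D i => i

theorem idx_nx (u : Vx) : idx (P.nx u) = idx u := by
  cases u with
  | N i j => simp only [nx]; split_ifs <;> rfl
  | C i => rfl
  | D i => rfl

theorem fvs_lower (S : Finset P.H.V) (hS : P.H.IsFVS S) : P.f ≤ S.card := by
  classical
  set S' : Finset Vx := S.image Subtype.val with hS'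
  have hcard : S'.card = S.card := Finset.card_image_of_injective _ Subtype.val_injective
  set M := (S'.filter (fun v => P.T v)).toList with hM
  have hMmem : ∀ v, v ∈ M ↔ v ∈ S' ∧ P.T v := by
    intro v; rw [hM, Finset.mem_toList, Finset.mem_filter]
  set Y := S'.filter (fun v => ¬ P.T v) with hY
  have hlen : Y.card + M.length = S'.card := by
    rw [hM, Finset.length_toList, hY, add_comm]
    exact Finset.card_filter_add_card_filter_not _
  set G : Set Vx := {u | ¬ isT u ∧ P.Valid u} with hG
  obtain ⟨v1, v2⟩ := tau_val P.nx P.m1 P.m2 {c | P.T c} P.m1_inj P.m2_inj P.m12_ne M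
    (fun k hk => ((hMmem k).1 hk).2) (Finset.nodup_toList _)
  set t := tau P.nx P.m1 P.m2 M with ht
  have htG : ∀ u ∈ G, t u ∈ G := by
    intro u hu
    by_cases h : ∃ k ∈ M, P.m1 k = u ∨ P.m2 k = u
    · obtain ⟨k, hk, rfl | rfl⟩ := h
      · rw [(v2 k hk).1]
        have := P.m2_ok k ((hMmem k).1 hk).2
        exact ⟨P.isT_nx _ this.1, P.valid_nx _ this.2⟩
      · rw [(v2 k hk).2]
        have := P.m1_ok k ((hMmem k).1 hk).2
        exact ⟨P.isT_nx _ this.1, P.valid_nx _ this.2⟩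
    · push Not at h
      rw [v1 u h]
      exact ⟨P.isT_nx _ hu.1, P.valid_nx _ hu.2⟩
  have hhit : ∀ u ∈ G, ∃ k, t^[k] u ∈ Y := by
    intro u hu
    by_contra hcon
    push Not at hcon
    have hOG : ∀ k, t^[k] u ∈ G := by
      intro k
      induction k with
      | zero => exact hu
      | succ k ih => rw [Function.iterate_succ_apply']; exact htG _ ih
    set O : Set Vx := {v | ∃ k, t^[k] u = v} with hO
    have hOt : ∀ v ∈ O, t v ∈ O := by
      rintro v ⟨k, rfl⟩
      exact ⟨k+1, by rw [Function.iterate_succ_apply']⟩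
    have hO1 : ∀ v ∈ O, v ∈ G := by rintro v ⟨k, rfl⟩; exact hOG k
    have hO2 : ∀ v ∈ O, v ∉ S' := by
      rintro v hv hv'
      obtain ⟨k, rfl⟩ := hv
      apply hcon k
      rw [hY, Finset.mem_filter]
      exact ⟨hv', fun hT => (hOG k).1 hT.1⟩
    have hM' : ∀ c, P.T c → c ∉ S' → ∀ k ∈ M, P.m1 k ≠ P.m1 c ∧ P.m2 k ≠ P.m1 c ∧
        P.m1 k ≠ P.m2 c ∧ P.m2 k ≠ P.m2 c := by
      intro c hc hcS k hk
      have hk' := (hMmem k).1 hk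
      have hne : k ≠ c := by rintro rfl; exact hcS hk'.1
      exact ⟨fun e => hne (P.m1_inj k hk'.2 c hc e), (P.m12_ne c hc k hk'.2).symm,
        P.m12_ne k hk'.2 c hc, fun e => hne (P.m2_inj k hk'.2 c hc e)⟩
    set W : Set P.H.V := {v | v.1 ∈ O ∨ (P.T v.1 ∧ v.1 ∉ S' ∧ (P.m1 v.1 ∈ O ∨ P.m2 v.1 ∈ O))}
      with hW
    obtain ⟨l, hl, hlW⟩ := exists_dicycle P.H W
      ⟨⟨u, (P.mem_vs u).2 hu.2⟩, Or.inl ⟨0, rfl⟩⟩ (by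
        rintro ⟨v, hv⟩ (hvO | ⟨hT, hvS, hv1⟩)
        · have hvO : v ∈ O := hvO
          by_cases hm : ∃ c, P.T c ∧ (P.m1 c = v ∨ P.m2 c = v)
          · obtain ⟨c, hc, hcv⟩ := hm
            by_cases hcS : c ∈ S'
            · have hcM := (hMmem c).2 ⟨hcS, hc⟩
              rcases hcv with rfl | rfl
              · have h1 := hOt _ hvO
                rw [(v2 c hcM).1] at h1
                exact ⟨⟨_, (P.mem_vs _).2 (hO1 _ h1).2⟩, Or.inl h1, Arc.s1 c hc⟩
              · have h1 := hOt _ hvO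
                rw [(v2 c hcM).2] at h1
                exact ⟨⟨_, (P.mem_vs _).2 (hO1 _ h1).2⟩, Or.inl h1, Arc.s2 c hc⟩
            · rcases hcv with rfl | rfl
              · exact ⟨⟨c, (P.mem_vs _).2 hc.2⟩, Or.inr ⟨hc, hcS, Or.inl hvO⟩, Arc.i1 c hc⟩
              · exact ⟨⟨c, (P.mem_vs _).2 hc.2⟩, Or.inr ⟨hc, hcS, Or.inr hvO⟩, Arc.i2 c hc⟩
          · push Not at hm
            have h1 := hOt _ hvO
            rw [v1 v (fun k hk => hm k ((hMmem k).1 hk).2)] at h1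
            exact ⟨⟨_, (P.mem_vs _).2 (hO1 _ h1).2⟩, Or.inl h1,
              Arc.pl v (hO1 _ hvO).1 (hO1 _ hvO).2 hm⟩
        · rcases hv1 with hv1 | hv1
          · have h1 := hOt _ hv1
            rw [v1 _ (fun k hk => ⟨(hM' v hT hvS k hk).1, (hM' v hT hvS k hk).2.1⟩)] at h1
            exact ⟨⟨_, (P.mem_vs _).2 (hO1 _ h1).2⟩, Or.inl h1, Arc.o1 v hT⟩
          · have h1 := hOt _ hv1
            rw [v1 _ (fun k hk => ⟨(hM' v hT hvS k hk).2.2.1, (hM' v hT hvS k hk).2.2.2⟩)] at h1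
            exact ⟨⟨_, (P.mem_vs _).2 (hO1 _ h1).2⟩, Or.inl h1, Arc.o2 v hT⟩)
    obtain ⟨s, hs, hsl⟩ := hS l hl
    have hs' : s.1 ∈ S' := Finset.mem_image.2 ⟨s, hs, rfl⟩
    rcases hlW s hsl with h | h
    · exact hO2 _ h hs'
    · exact h.2.1 hs'
  obtain ⟨Y', h1, h2⟩ := tau_hit P.nx P.m1 P.m2 G M
    (fun k hk => P.m1_ok k ((hMmem k).1 hk).2) Y hhit
  have h3 : Finset.range P.f ⊆ Y'.image idx := by
    intro i hi
    rw [Finset.mem_range] at hi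
    have := P.hx i hi
    obtain ⟨k, hk⟩ := h2 (N i 0) ⟨fun h => h, hi, by omega⟩
    rw [Finset.mem_image]
    refine ⟨_, hk, ?_⟩
    clear hk
    induction k with
    | zero => rfl
    | succ k ih => rw [Function.iterate_succ_apply', P.idx_nx, ih]
  have h4 := Finset.card_le_card h3
  have h5 := Finset.card_image_le (s := Y') (f := idx)
  rw [Finset.card_range] at h4
  omega
end Par

namespace Par
open Vx
variable (P : Par)

/-- Explicit description of the arcs. -/
inductive E : Vx → Vx → Prop
  | st (i j : ℕ) (hi : i < P.f) (hj : j + 1 < P.x i + P.y i) (h1 : j + 1 = P.x i → i = 0)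
      (h2 : P.a i = 1 → j + 1 ≠ P.p i)
      (h3 : 3 ≤ i → P.a (i-3) = 1 → j + 1 ≠ P.x i + P.r i) : E (N i j) (N i (j+1))
  | wr (i j k : ℕ) (hi : i + 1 = P.f) (hj : j + 1 = P.x i + P.y i) (hk : k = 0) :
      E (N i j) (N i k)
  | c1 (i j : ℕ) (hi : i + 1 < P.f) (hj : j + 1 = P.x i + P.y i) : E (N i j) (C i)
  | c2 (i i' j : ℕ) (hi : i + 1 < P.f) (e : i' = i + 1) (hj : j + 1 = P.x i') : E (N i' j) (C i)
  | c3 (i k : ℕ) (hi : i + 1 < P.f) (hk : k = 0) : E (C i) (N i k)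
  | c4 (i i' k : ℕ) (hi : i + 1 < P.f) (e : i' = i + 1) (hk : k = P.x i') : E (C i) (N i' k)
  | c5 (i i' j k : ℕ) (hi : i + 1 < P.f) (e : i' = i + 1) (hj : j + 1 = P.x i + P.y i)
      (hk : k = P.x i') : E (N i j) (N i' k)
  | c6 (i i' j k : ℕ) (hi : i + 1 < P.f) (e : i' = i + 1) (hj : j + 1 = P.x i') (hk : k = 0) :
      E (N i' j) (N i k)
  | d1 (i j : ℕ) (hi : P.a i = 1) (hj : j + 1 = P.p i) : E (N i j) (D i)
  | d2 (i i' j : ℕ) (hi : P.a i = 1) (e : i' = i + 3) (hj : j + 1 = P.x i' + P.r i') :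
      E (N i' j) (D i)
  | d3 (i k : ℕ) (hi : P.a i = 1) (hk : k = P.p i) : E (D i) (N i k)
  | d4 (i i' k : ℕ) (hi : P.a i = 1) (e : i' = i + 3) (hk : k = P.x i' + P.r i') :
      E (D i) (N i' k)
  | d5 (i i' j k : ℕ) (hi : P.a i = 1) (e : i' = i + 3) (hj : j + 1 = P.p i)
      (hk : k = P.x i' + P.r i') : E (N i j) (N i' k)
  | d6 (i i' j k : ℕ) (hi : P.a i = 1) (e : i' = i + 3) (hj : j + 1 = P.x i' + P.r i')
      (hk : k = P.p i) : E (N i' j) (N i k)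

theorem nx_m1_C (i : ℕ) (h : i + 1 < P.f) : P.nx (P.m1 (C i)) = N i 0 := by
  have := P.hx i (by omega)
  simp only [m1, nx]
  rw [if_pos (by omega)]

theorem nx_m2_C (i : ℕ) (h : i + 1 < P.f) : P.nx (P.m2 (C i)) = N (i+1) (P.x (i+1)) := by
  have := P.hx (i+1) (by omega)
  have := P.hy (i+1) (by omega)
  simp only [m2, nx]
  rw [if_neg (by omega)]
  congr 1; omega

theorem nx_m1_D (i : ℕ) (h : P.a i = 1) : P.nx (P.m1 (D i)) = N i (P.p i) := by
  have := P.ha i h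
  simp only [m1, nx]
  rw [if_neg (by omega)]
  congr 1; omega

theorem nx_m2_D (i : ℕ) (h : P.a i = 1) :
    P.nx (P.m2 (D i)) = N (i+3) (P.x (i+3) + P.r (i+3)) := by
  have := P.ha i h
  have := P.hx (i+3) (by omega)
  simp only [m2, nx]
  rw [if_neg (by omega)]
  congr 1; omega

theorem arc_E {u v : Vx} (h : P.Arc u v) : P.E u v := by
  have mC : ∀ i, i + 1 < P.f → P.x i + P.y i - 1 + 1 = P.x i + P.y i := by
    intro i h; have := P.hx i (by omega); omega
  have mC2 : ∀ i, i + 1 < P.f → P.x (i+1) - 1 + 1 = P.x (i+1) := by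
    intro i h; have := P.hx (i+1) (by omega); omega
  have mD : ∀ i, P.a i = 1 → P.p i - 1 + 1 = P.p i := by
    intro i h; have := P.ha i h; omega
  have mD2 : ∀ i, P.a i = 1 → P.x (i+3) + P.r (i+3) - 1 + 1 = P.x (i+3) + P.r (i+3) := by
    intro i h; have := P.ha i h; omega
  cases h with
  | pl u h1 h2 h3 =>
    cases u with
    | C i => exact (h1 trivial).elim
    | D i => exact (h1 trivial).elim
    | N i j =>
      obtain ⟨h4, h5⟩ := h2
      by_cases hw : j + 1 = P.x i + P.y i
      · simp only [nx]
        rw [if_pos hw]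
        refine E.wr i j 0 ?_ hw rfl
        by_contra hne
        refine (h3 (C i) ⟨trivial, by simp only [Valid]; omega⟩).1 ?_
        simp only [m1]; congr 1; omega
      · simp only [nx]
        rw [if_neg hw]
        refine E.st i j h4 (by omega) ?_ ?_ ?_
        · intro e
          by_contra hne
          refine (h3 (C (i-1)) ⟨trivial, by simp only [Valid]; omega⟩).2 ?_
          have : i - 1 + 1 = i := by omega
          simp only [m2, this]; congr 1; omega
        · intro ha e
          refine (h3 (D i) ⟨trivial, ha⟩).1 ?_
          simp only [m1]; congr 1; omega
        · intro h6 ha e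
          refine (h3 (D (i-3)) ⟨trivial, ha⟩).2 ?_
          have : i - 3 + 3 = i := by omega
          simp only [m2, this]; congr 1; omega
  | i1 c h =>
    cases v with
    | N i j => exact h.1.elim
    | C i => exact E.c1 _ _ h.2 (mC i h.2)
    | D i => exact E.d1 _ _ h.2 (mD i h.2)
  | i2 c h =>
    cases v with
    | N i j => exact h.1.elim
    | C i => exact E.c2 _ _ _ h.2 rfl (mC2 i h.2)
    | D i => exact E.d2 _ _ _ h.2 rfl (mD2 i h.2)
  | o1 c h =>
    cases u with
    | N i j => exact h.1.elim
    | C i => rw [P.nx_m1_C i h.2]; exact E.c3 _ _ h.2 rfl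
    | D i => rw [P.nx_m1_D i h.2]; exact E.d3 _ _ h.2 rfl
  | o2 c h =>
    cases u with
    | N i j => exact h.1.elim
    | C i => rw [P.nx_m2_C i h.2]; exact E.c4 _ _ _ h.2 rfl rfl
    | D i => rw [P.nx_m2_D i h.2]; exact E.d4 _ _ _ h.2 rfl rfl
  | s1 c h =>
    cases c with
    | N i j => exact h.1.elim
    | C i => rw [P.nx_m2_C i h.2]; exact E.c5 _ _ _ _ h.2 rfl (mC i h.2) rfl
    | D i => rw [P.nx_m2_D i h.2]; exact E.d5 _ _ _ _ h.2 rfl (mD i h.2) rfl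
  | s2 c h =>
    cases c with
    | N i j => exact h.1.elim
    | C i => rw [P.nx_m1_C i h.2]; exact E.c6 _ _ _ _ h.2 rfl (mC2 i h.2) rfl
    | D i => rw [P.nx_m1_D i h.2]; exact E.d6 _ _ _ _ h.2 rfl (mD2 i h.2) rfl

/-- The raw vertex set of a directed cycle. -/
theorem cyc_set {l : List P.H.V} (h : P.H.IsDicycle l) :
    ∃ U : Finset Vx, U.card = l.length ∧ U.Nonempty ∧ (∀ u ∈ U, P.Valid u) ∧
    (∀ u ∈ U, ∃ v ∈ U, P.E u v) ∧ (∀ u ∈ U, ∃ v ∈ U, P.E v u) ∧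
    (∀ u : P.H.V, u.1 ∈ U → u ∈ l) := by
  obtain ⟨h1, h2, h3, h4⟩ := h.closed
  refine ⟨l.toFinset.image (fun v : P.H.V => v.1), ?_, ?_, ?_, ?_, ?_, ?_⟩
  · rw [← h2]
    exact Finset.card_image_of_injective _ Subtype.val_injective
  · exact h1.image _
  · intro u hu
    obtain ⟨v, hv, rfl⟩ := Finset.mem_image.1 hu
    exact (P.mem_vs _).1 v.2
  · intro u hu
    obtain ⟨v, hv, rfl⟩ := Finset.mem_image.1 hu
    obtain ⟨w, hw, hvw⟩ := h3 v hv
    exact ⟨w.1, Finset.mem_image.2 ⟨w, hw, rfl⟩, P.arc_E hvw⟩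
  · intro u hu
    obtain ⟨v, hv, rfl⟩ := Finset.mem_image.1 hu
    obtain ⟨w, hw, hvw⟩ := h4 v hv
    exact ⟨w.1, Finset.mem_image.2 ⟨w, hw, rfl⟩, P.arc_E hvw⟩
  · intro u hu
    obtain ⟨v, hv, e⟩ := Finset.mem_image.1 hu
    have : v = u := Subtype.ext e
    rw [← this]
    exact List.mem_toFinset.1 hv

def rk : Vx → ℕ
  | N i j => i * (P.g + 5) + if P.x i ≤ j then j - P.x i else P.y i + 1 + j
  | C i => i * (P.g + 5) + P.y i
  | D i => i * (P.g + 5) + P.y i + 1 + P.x i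

theorem xy_le (i : ℕ) (hi : i < P.f) : P.x i + P.y i ≤ P.g := by
  have := P.hdeg i hi; omega

theorem no_avoid (U : Finset Vx) (hne : U.Nonempty) (hV : ∀ u ∈ U, P.Valid u)
    (hs : ∀ u ∈ U, ∃ v ∈ U, P.E u v) (hav : ∀ i, N i (P.x i - 1) ∉ U) : False := by
  have c1 : ∀ d i j, d + j + 1 = P.x i → (P.a i = 1 → P.p i ≤ j) → N i j ∉ U := by
    intro d
    induction d with
    | zero =>
      intro i j h1 h2 hU
      apply hav i
      rwa [show P.x i - 1 = j by omega]
    | succ d ih =>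
      intro i j h1 h2 hU
      obtain ⟨v, hv, hE⟩ := hs _ hU
      have hV' := hV _ hU
      obtain ⟨h3, h4⟩ := hV'
      have := P.hy i h3
      cases hE with
      | st => exact ih i (j+1) (by omega) (fun h => by have := h2 h; omega) hv
      | wr => omega
      | c1 => omega
      | c2 => omega
      | c5 => omega
      | c6 => omega
      | d1 => have := h2 ‹_›; omega
      | d2 => omega
      | d5 => have := h2 ‹_›; omega
      | d6 => omega
  obtain ⟨u, hu, hmax⟩ := U.exists_max_image P.rk hne
  obtain ⟨v, hv, hE⟩ := hs u hu
  have hm := hmax v hv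
  have hVu := hV u hu
  have hVv := hV v hv
  have c1' : ∀ i j, N i j ∈ U → P.x i ≤ j ∨ (P.a i = 1 ∧ j < P.p i) := by
    intro i j h
    by_contra hcon
    push Not at hcon
    exact c1 (P.x i - 1 - j) i j (by omega) hcon.2 h
  cases hE with
  | st i j hi hj h1 h2 h3 =>
    have := P.xy_le i hi
    have h4 := c1' _ _ hu
    have h5 := c1' _ _ hv
    simp only [rk] at hm
    have : j + 1 ≠ P.x i := fun e => hav i (by rwa [show P.x i - 1 = j by omega])
    split_ifs at hm <;> omega
  | wr i j k hi hj hk =>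
    subst hk
    have h4 := c1' _ _ hv
    have := P.hx i (by omega)
    rcases h4 with h | h
    · omega
    · have := P.ha i h.1
      omega
  | c1 i j hi hj =>
    have := P.xy_le i (by omega)
    have := P.hy i (by omega)
    simp only [rk] at hm
    split_ifs at hm <;> omega
  | c2 i i' j hi e hj => exact hav i' (by rwa [show P.x i' - 1 = j by omega])
  | c3 i k hi hk =>
    have := P.hx i (by omega)
    simp only [rk] at hm
    split_ifs at hm <;> omega
  | c4 i i' k hi e hk =>
    subst e
    have := P.xy_le i (by omega)
    simp only [rk, add_mul] at hm
    split_ifs at hm <;> omega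
  | c5 i i' j k hi e hj hk =>
    subst e
    have := P.xy_le i (by omega)
    simp only [rk, add_mul] at hm
    split_ifs at hm <;> omega
  | c6 i i' j k hi e hj => exact hav i' (by rwa [show P.x i' - 1 = j by omega])
  | d1 i j hi hj =>
    have := P.ha i hi
    simp only [rk] at hm
    split_ifs at hm <;> omega
  | d2 i i' j hi e hj =>
    subst e
    obtain ⟨w, hw, hE'⟩ := hs _ hv
    have hm' := hmax w hw
    have := P.ha i hi
    cases hE' with
    | d3 _ k _ hk =>
      have := c1' _ _ hw
      omega
    | d4 _ i' k _ e hk =>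
      subst e
      have := P.hx (i+3) (by omega)
      simp only [rk, add_mul] at hm'
      split_ifs at hm' <;> omega
  | d3 i k hi hk =>
    have := c1' _ _ hv
    have := P.ha i hi
    omega
  | d4 i i' k hi e hk =>
    subst e
    have := P.ha i hi
    have := P.xy_le i (by omega)
    simp only [rk, add_mul] at hm
    split_ifs at hm <;> omega
  | d5 i i' j k hi e hj hk =>
    subst e
    have := P.ha i hi
    have := P.xy_le i (by omega)
    simp only [rk, add_mul] at hm
    split_ifs at hm <;> omega
  | d6 i i' j k hi e hj hk =>
    have := c1' _ _ hv
    have := P.ha i hi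
    omega

theorem fvs_eq : P.H.fvs = P.f := by
  have key : ∃ S : Finset P.H.V, P.H.IsFVS S ∧ S.card ≤ P.f := by
    set F : Fin P.f → P.H.V := fun i => ⟨N i.1 (P.x i.1 - 1), (P.mem_vs _).2 (by
      have := P.hx i.1 i.2
      exact ⟨i.2, by omega⟩)⟩ with hF
    refine ⟨Finset.univ.image F, ?_, ?_⟩
    · intro l hl
      obtain ⟨U, -, h2, h3, h4, h5, h6⟩ := P.cyc_set hl
      by_contra hcon
      push Not at hcon
      refine P.no_avoid U h2 h3 h4 ?_
      intro i hi
      have hlt : i < P.f := (h3 _ hi).1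
      exact hcon (F ⟨i, hlt⟩) (Finset.mem_image_of_mem _ (Finset.mem_univ _)) (h6 _ hi)
    · refine Finset.card_image_le.trans ?_
      simp
  obtain ⟨S, hS, hc⟩ := key
  apply le_antisymm
  · have h0 : S.card ∈ {n | ∃ S : Finset P.H.V, P.H.IsFVS S ∧ S.card = n} := ⟨S, hS, rfl⟩
    exact (Nat.sInf_le h0).trans hc
  · have hne : {n | ∃ S : Finset P.H.V, P.H.IsFVS S ∧ S.card = n}.Nonempty := ⟨_, S, hS, rfl⟩
    obtain ⟨S', hS', h⟩ := Nat.sInf_mem hne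
    unfold Digr.fvs
    rw [← h]
    exact P.fvs_lower S' hS'
end Par

namespace Par
variable (P : Par)

/-- `b i = 1` iff the chord `D (i-3)` exists. -/
def b (i : ℕ) : ℕ := if 3 ≤ i then P.a (i-3) else 0
/-- number of the first segment of the `x`-part -/
def fx (i : ℕ) : ℕ := if P.a i = 1 then 0 else 1
/-- number of the first segment of the `y`-part -/
def fy (i : ℕ) : ℕ := if P.b i = 1 then 2 else 3
def pp (i : ℕ) : ℕ := if P.a i = 1 then P.p i else 0
def rr (i : ℕ) : ℕ := if P.b i = 1 then P.r i else 0
/-- length of the first segment of the `x`-part -/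
def lx (i : ℕ) : ℕ := if P.a i = 1 then P.p i else P.x i

theorem b_add (i : ℕ) : P.b (i+3) = P.a i := by
  unfold b; rw [if_pos (by omega)]; congr 1

/-- Segment calculus of a closed set of vertices. -/
structure Sg (s : ℕ → ℕ → Prop) (c : ℕ → ℕ → ℕ) (n : ℕ) : Prop where
  v0 : ∀ i, s i 0 → P.a i = 1
  v2 : ∀ i, s i 2 → P.b i = 1
  vf : ∀ i k, s i k → k ≤ 3 → i < P.f
  r1 : ∀ i, i + 1 < P.f → s i 3 → s (i+1) 4 ∨ s (i+1) (P.fy (i+1))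
  r2 : ∀ i, s (i+1) 1 → s (i+1) 4 ∨ s i (P.fx i)
  r2z : s 0 1 → s 0 3
  r3 : ∀ i, s i 0 → s (i+3) 5 ∨ s (i+3) 3
  r4 : ∀ i, s (i+3) 2 → s (i+3) 5 ∨ s i 1
  r5 : ∀ i, i + 1 < P.f → s i (P.fx i) → s (i+1) 4 ∨ s (i+1) 1
  r6 : ∀ i, s (i+1) (P.fy (i+1)) → s (i+1) 4 ∨ s i 3
  r6z : s 0 3 → s 0 1
  r7 : ∀ i, P.a i = 1 → s i 1 → s (i+3) 5 ∨ s (i+3) 2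
  r8 : ∀ i, P.a i = 1 → s (i+3) 3 → s (i+3) 5 ∨ s i 0
  r9 : ∀ i, s (i+1) 4 → (s i 3 ∨ s (i+1) 1) ∧ (s i (P.fx i) ∨ s (i+1) (P.fy (i+1)))
  r10 : ∀ i, s (i+3) 5 → (s i 0 ∨ s (i+3) 2) ∧ (s i 1 ∨ s (i+3) 3)
  rl : ∀ i, i + 1 = P.f → s i 3 → s i 1
  l0 : ∀ i, s i 0 → P.p i ≤ c i 0
  l1 : ∀ i, s i 1 → P.x i ≤ c i 1 + P.pp i
  l2 : ∀ i, s i 2 → P.r i ≤ c i 2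
  l3 : ∀ i, s i 3 → P.y i ≤ c i 3 + P.rr i
  l4 : ∀ i, s i 4 → 1 ≤ c i 4
  l5 : ∀ i, s i 5 → 1 ≤ c i 5
  hne : ∃ i k, k ≤ 3 ∧ s i k
  hsum : ∀ L : List (ℕ × ℕ), L.Nodup → (L.map (fun k => c k.1 k.2)).sum ≤ n

/-- Numerical conditions guaranteeing digirth `g`. -/
structure Good : Prop where
  e1 : ∀ m, P.a m = 1 → P.p m ≤ 3 ∧ P.p m + 2 ≤ P.y (m+1) + P.y (m+2) + P.r (m+3)
  nn : ∀ m, P.a m = 1 → P.a (m+1) = 1 ∨ P.a (m+2) = 1 ∨ m + 4 = P.f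
  g1 : ∀ m, P.a m = 1 → P.a (m+1) = 1 →
    P.g + P.p (m+1) + P.r (m+3) ≤ P.p m + P.x (m+1) + P.y (m+3) + P.r (m+4) ∧ P.r (m+4) ≤ 4
  g2 : ∀ m, P.a m = 1 → P.a (m+1) = 0 → P.a (m+2) = 1 →
    P.g + P.p (m+2) + P.r (m+3) ≤
      P.p m + P.x (m+1) + P.x (m+2) + P.y (m+3) + P.y (m+4) + P.r (m+5) ∧
    P.r (m+5) ≤ 4 ∧
    P.y (m+4) + P.pp (m+5) ≤ 2 + P.lx (m+3) + P.x (m+5) ∧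
    P.y (m+4) + P.r (m+5) ≤ 2 + P.lx (m+3) + P.p (m+2) + P.a (m+3)
  ll : ∀ m, P.a m = 1 → m + 4 = P.f → P.r (m+3) + 1 ≤ P.p m + P.x (m+1)


variable {P}
namespace Sg
variable {s : ℕ → ℕ → Prop} {c : ℕ → ℕ → ℕ} {n : ℕ}

theorem lfx (S : P.Sg s c n) (i : ℕ) (hi : i < P.f) (h : s i (P.fx i)) :
    P.lx i ≤ c i 0 + c i 1 ∧ 1 ≤ P.lx i := by
  have := P.hx i hi
  unfold fx at h
  unfold lx
  split_ifs at h ⊢ with h1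
  · have := S.l0 i h
    have := P.ha i h1
    omega
  · have := S.l1 i h
    unfold pp at this
    rw [if_neg h1] at this; omega

theorem pos1 (S : P.Sg s c n) (i : ℕ) (h : s i 1) : 1 ≤ c i 1 := by
  have h1 := S.l1 _ h
  have h2 := P.hx i (S.vf _ _ h (by omega))
  unfold pp at h1
  split_ifs at h1 with h3
  · have := P.ha _ h3; omega
  · omega

theorem pos2 (S : P.Sg s c n) (i : ℕ) (h : s i 2) : 1 ≤ c i 2 := by
  have h1 := S.l2 _ h
  have h2 := S.v2 _ h
  unfold b at h2
  split_ifs at h2 with h3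
  have h4 := P.ha _ h2
  rw [show i - 3 + 3 = i by omega] at h4
  omega

theorem pos3 (S : P.Sg s c n) (i : ℕ) (h : s i 3) : 1 ≤ c i 3 := by
  have h1 := S.l3 _ h
  have h2 := P.hy i (S.vf _ _ h (by omega))
  unfold rr at h1
  split_ifs at h1 with h3
  · unfold b at h3
    split_ifs at h3 with h5
    have h4 := P.ha _ h3
    rw [show i - 3 + 3 = i by omega] at h4
    omega
  · omega

/-- All of the `y`-part is used, if nothing is used of row `i - 3`. -/
theorem fully (S : P.Sg s c n) (i : ℕ) (hlow : 3 ≤ i → ¬ s (i-3) 1 ∧ ¬ s (i-3) 0)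
    (h : s i (P.fy i) ∨ s i 3) :
    s i 3 ∧ P.y i + P.b i ≤ c i 2 + c i 3 + c i 5 := by
  by_cases hb : P.b i = 1
  · obtain ⟨k, rfl⟩ : ∃ k, i = k + 3 := by
      unfold b at hb
      split_ifs at hb with h3
      exact ⟨i - 3, by omega⟩
    have hl := hlow (by omega)
    simp only [Nat.add_sub_cancel] at hl
    have ha : P.a k = 1 := by rwa [P.b_add] at hb
    have h5 : s (k+3) 5 := by
      rcases h with h | h
      · rw [fy, if_pos hb] at h
        exact (S.r4 k h).resolve_right hl.1
      · exact (S.r8 k ha h).resolve_right hl.2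
    have h10 := S.r10 k h5
    have h2 := h10.1.resolve_left hl.2
    have h3 := h10.2.resolve_left hl.1
    have := S.l2 _ h2
    have := S.l3 _ h3
    have := S.l5 _ h5
    rw [rr, if_pos hb] at *
    exact ⟨h3, by omega⟩
  · have h3 : s i 3 := by
      rcases h with h | h
      · rwa [fy, if_neg hb] at h
      · exact h
    have := S.l3 _ h3
    rw [rr, if_neg hb] at this
    have hb0 : P.b i = 0 := by
      unfold b at hb ⊢
      split_ifs at hb ⊢ with h4
      · have := P.ha1 (i-3); omega
      · rfl
    exact ⟨h3, by omega⟩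

theorem caseE (S : P.Sg s c n) (G : P.Good) (m : ℕ) (hlow : ∀ i k, i < m → k ≤ 3 → ¬ s i k)
    (h : s m 1 ∨ s m 2 ∨ s m 3) : P.g ≤ n := by
  have hmf : m < P.f := by
    rcases h with h | h | h <;> exact S.vf _ _ h (by omega)
  have h13 : s m 1 ∧ s m 3 ∧ P.y m + P.b m ≤ c m 2 + c m 3 + c m 5 ∧ (0 < m → 1 ≤ c m 4) := by
    have F := S.fully m (fun h3 => ⟨hlow _ _ (by omega) (by omega), hlow _ _ (by omega) (by omega)⟩)
    have h' : s m (P.fy m) ∨ s m 3 ∨ s m 1 := by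
      rcases h with h | h | h
      · exact Or.inr (Or.inr h)
      · left; rw [fy, if_pos (S.v2 _ h)]; exact h
      · exact Or.inr (Or.inl h)
    have h'' : s m (P.fy m) ∨ s m 3 := by
      rcases h' with h | h | h
      · exact Or.inl h
      · exact Or.inr h
      · rcases Nat.eq_zero_or_pos m with rfl | hm
        · exact Or.inr (S.r2z h)
        · obtain ⟨k, rfl⟩ : ∃ k, m = k + 1 := ⟨m - 1, by omega⟩
          have hfx : ¬ s k (P.fx k) := hlow _ _ (by omega) (by unfold fx; split_ifs <;> omega)
          have h4 := (S.r2 k h).resolve_right hfx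
          exact Or.inl ((S.r9 k h4).2.resolve_left hfx)
    obtain ⟨h3, hc⟩ := F h''
    rcases Nat.eq_zero_or_pos m with rfl | hm
    · exact ⟨S.r6z h3, h3, hc, fun h => by omega⟩
    · obtain ⟨k, rfl⟩ : ∃ k, m = k + 1 := ⟨m - 1, by omega⟩
      have h3' : ¬ s k 3 := hlow _ _ (by omega) (by omega)
      have hfx : ¬ s k (P.fx k) := hlow _ _ (by omega) (by unfold fx; split_ifs <;> omega)
      have hfy : s (k+1) (P.fy (k+1)) := by
        by_cases hb : P.b (k+1) = 1
        · rw [fy, if_pos hb]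
          obtain ⟨j, hj⟩ : ∃ j, k + 1 = j + 3 := by
            unfold b at hb
            split_ifs at hb with h3
            exact ⟨k - 2, by omega⟩
          rw [hj] at h3 hb ⊢
          rw [P.b_add] at hb
          have h0 : ¬ s j 0 := hlow _ _ (by omega) (by omega)
          have h5 := (S.r8 j hb h3).resolve_right h0
          exact (S.r10 j h5).1.resolve_left h0
        · rw [fy, if_neg hb]; exact h3
      have h4 := (S.r6 k hfy).resolve_right h3'
      exact ⟨(S.r9 k h4).1.resolve_left h3', h3, hc, fun _ => S.l4 _ h4⟩
  obtain ⟨h1, h3, hc, hc4⟩ := h13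
  have hd := P.hdeg m hmf
  have hbd : (if 3 ≤ m then P.a (m-3) else 0) = P.b m := rfl
  rw [hbd] at hd
  clear hbd
  have hm4 : (if 0 < m then 1 else 0) ≤ c m 4 := by
    split_ifs with h
    · exact hc4 h
    · omega
  have l1 := S.l1 _ h1
  by_cases ha : P.a m = 1
  · have hma := P.ha m ha
    rw [pp, if_pos ha] at l1
    rw [if_pos (by omega : m + 1 < P.f)] at hd
    have fx0 : P.fx m = 0 := by rw [fx, if_pos ha]
    by_cases h0 : s m 0
    · have e1 := S.r5 m (by omega) (by rw [fx0]; exact h0)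
      have e2 := S.r7 m ha h1
      have := S.hsum [(m,0),(m,1),(m,2),(m,3),(m,4),(m,5),(m+1,4),(m+1,1),(m+3,5),(m+3,2)]
        (by simp)
      simp at this
      have := S.l0 _ h0
      have k1 : 1 ≤ c (m+1) 4 + c (m+1) 1 := by
        rcases e1 with e | e
        · have := S.l4 _ e; omega
        · have := S.pos1 _ e; omega
      have k2 : 1 ≤ c (m+3) 5 + c (m+3) 2 := by
        rcases e2 with e | e
        · have := S.l5 _ e; omega
        · have := S.l2 _ e; omega
      omega
    · have y1 : s (m+1) (P.fy (m+1)) := by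
        rcases S.r1 m (by omega) h3 with h | h
        · exact (S.r9 m h).2.resolve_left (by rw [fx0]; exact h0)
        · exact h
      have z2 : s (m+3) 2 := by
        rcases S.r7 m ha h1 with h | h
        · exact (S.r10 m h).1.resolve_left h0
        · exact h
      obtain ⟨y3, yc⟩ := S.fully (m+1) (fun _ => ⟨hlow _ _ (by omega) (by omega),
        hlow _ _ (by omega) (by omega)⟩) (Or.inl y1)
      have hb3 : P.b (m+3) = 1 := by rw [P.b_add, ha]
      have l2 := S.l2 _ z2
      have e1 := G.e1 m ha
      by_cases w : s (m+2) (P.fy (m+2))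
      · obtain ⟨w3, wc⟩ := S.fully (m+2) (fun _ => ⟨hlow _ _ (by omega) (by omega),
          hlow _ _ (by omega) (by omega)⟩) (Or.inl w)
        have := S.hsum [(m,1),(m,2),(m,3),(m,4),(m,5),(m+1,2),(m+1,3),(m+1,5),(m+2,2),(m+2,3),
          (m+2,5),(m+3,2)] (by simp)
        simp at this
        omega
      · have t4 := (S.r1 (m+1) (by omega) y3).resolve_right w
        have tx := (S.r9 (m+1) t4).2.resolve_right w
        have k1 := S.lfx _ (by omega) tx
        have k2 : 1 ≤ c (m+2) 4 := S.l4 _ t4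
        have k3 : 1 ≤ c (m+3) 4 + c (m+2) 3 := by
          rcases S.r6 (m+2) (by rw [fy, if_pos hb3]; exact z2) with h | h
          · have : 1 ≤ c (m+3) 4 := S.l4 _ h
            omega
          · have := S.pos3 _ h; omega
        have := P.hy (m+1) (by omega)
        have := S.hsum [(m,1),(m,2),(m,3),(m,4),(m,5),(m+1,2),(m+1,3),(m+1,5),(m+1,0),(m+1,1),
          (m+2,4),(m+3,4),(m+2,3),(m+3,2)] (by simp)
        simp at this
        omega
  · have ha0 : P.a m = 0 := by have := P.ha1 m; omega
    rw [pp, if_neg ha] at l1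
    have fx1 : P.fx m = 1 := by rw [fx, if_neg ha]
    have := S.hsum [(m,1),(m,2),(m,3),(m,4),(m,5),(m+1,4),(m+1,1)] (by simp)
    simp at this
    by_cases h1f : m + 1 < P.f
    · rw [if_pos h1f] at hd
      have k1 : 1 ≤ c (m+1) 4 + c (m+1) 1 := by
        rcases S.r5 m h1f (by rw [fx1]; exact h1) with e | e
        · have := S.l4 _ e; omega
        · have := S.pos1 _ e; omega
      rw [ha0] at hd
      omega
    · rw [ha0, if_neg h1f] at hd
      omega

theorem bound (S : P.Sg s c n) (G : P.Good) : P.g ≤ n := by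
  classical
  have hex : ∃ i, ∃ k, k ≤ 3 ∧ s i k := S.hne
  set m := Nat.find hex with hm
  obtain ⟨k, hk, hsk⟩ := Nat.find_spec hex
  have hlow : ∀ i k, i < m → k ≤ 3 → ¬ s i k := by
    intro i k hi hk hs
    exact Nat.find_min hex hi ⟨k, hk, hs⟩
  by_cases hE : s m 1 ∨ s m 2 ∨ s m 3
  · exact S.caseE G m hlow hE
  push Not at hE
  obtain ⟨n1, n2, n3⟩ := hE
  have h0 : s m 0 := by
    rw [← hm] at hsk
    clear_value m
    interval_cases k
    · exact hsk
    · exact (n1 hsk).elim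
    · exact (n2 hsk).elim
    · exact (n3 hsk).elim
  clear_value m
  have ha := S.v0 _ h0
  have hma := P.ha m ha
  have fx0 : P.fx m = 0 := by rw [fx, if_pos ha]
  have u3 : s (m+3) 3 := by
    rcases S.r3 m h0 with h | h
    · exact (S.r10 m h).2.resolve_left n1
    · exact h
  have v1 : s (m+1) 1 := by
    rcases S.r5 m (by omega) (by rw [fx0]; exact h0) with h | h
    · exact (S.r9 m h).1.resolve_left n3
    · exact h
  have hb3 : P.b (m+3) = 1 := by rw [P.b_add, ha]
  have l0 := S.l0 _ h0
  have l1 := S.l1 _ v1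
  have l3 := S.l3 _ u3
  rw [rr, if_pos hb3] at l3
  by_cases a1 : P.a (m+1) = 1
  · have hma1 := P.ha (m+1) a1
    have hb4 : P.b (m+4) = 1 := by rw [P.b_add (m+1), a1]
    have g1 := G.g1 m ha a1
    rw [pp, if_pos a1] at l1
    by_cases w : s (m+4) 2
    · have l2 := S.l2 _ w
      have := S.hsum [(m,0),(m+1,1),(m+3,3),(m+4,2)] (by simp)
      simp at this
      omega
    · have w5 : s (m+4) 5 := (S.r7 (m+1) a1 v1).resolve_right w
      have w0 := (S.r10 (m+1) w5).1.resolve_right w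
      have k1 : 1 ≤ c (m+2) 4 + c (m+2) 1 := by
        rcases S.r5 (m+1) (by omega) (by rw [fx, if_pos a1]; exact w0) with e | e
        · have : 1 ≤ c (m+2) 4 := S.l4 _ e
          omega
        · have : 1 ≤ c (m+2) 1 := S.pos1 _ e
          omega
      have hfy : ¬ s (m+3+1) (P.fy (m+3+1)) := by
        rw [fy, if_pos hb4]; exact w
      have w4 := (S.r1 (m+3) (by omega) u3).resolve_right hfy
      have wx := (S.r9 (m+3) w4).2.resolve_right hfy
      have k2 := S.lfx _ (by omega) wx
      have k3 : 1 ≤ c (m+4) 4 := S.l4 _ w4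
      have k4 : 1 ≤ c (m+4) 5 := S.l5 _ w5
      have k5 := S.l0 _ w0
      have := S.hsum [(m,0),(m+1,1),(m+3,3),(m+2,4),(m+2,1),(m+3,0),(m+3,1),(m+4,4),(m+4,5),
        (m+1,0)] (by simp)
      simp at this
      omega
  have a10 : P.a (m+1) = 0 := by have := P.ha1 (m+1); omega
  rw [pp, if_neg a1] at l1
  have fx1 : P.fx (m+1) = 1 := by rw [fx, if_neg a1]
  have hb4 : P.b (m+4) = 0 := by rw [P.b_add (m+1), a10]
  by_cases a2 : P.a (m+2) = 1
  · have hma2 := P.ha (m+2) a2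
    have hb5 : P.b (m+5) = 1 := by rw [P.b_add (m+2), a2]
    obtain ⟨g1, g2, g3, g4⟩ := G.g2 m ha a10 a2
    by_cases v2 : s (m+2) 1
    · have l12 := S.l1 _ v2
      rw [pp, if_pos a2] at l12
      have fy4 : P.fy (m+3+1) = 3 := by
        rw [fy, if_neg (by rw [show m+3+1 = m+4 from rfl, hb4]; omega)]
      have fy5 : P.fy (m+4+1) = 2 := by
        rw [fy, if_pos hb5]
      by_cases t : s (m+4) 3
      · have lt := S.l3 _ t
        rw [rr, if_neg (by rw [hb4]; omega)] at lt
        by_cases w : s (m+5) 2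
        · have l2 := S.l2 _ w
          have := S.hsum [(m,0),(m+1,1),(m+2,1),(m+3,3),(m+4,3),(m+5,2)] (by simp)
          simp at this
          omega
        · have w5 : s (m+5) 5 := (S.r7 (m+2) a2 v2).resolve_right w
          have w0 := (S.r10 (m+2) w5).1.resolve_right w
          have hfy : ¬ s (m+4+1) (P.fy (m+4+1)) := by rw [fy5]; exact w
          have w4 := (S.r1 (m+4) (by omega) t).resolve_right hfy
          have wx := (S.r9 (m+4) w4).2.resolve_right hfy
          have k2 := S.lfx _ (by omega) wx
          have k3 : 1 ≤ c (m+5) 4 := S.l4 _ w4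
          have k4 : 1 ≤ c (m+5) 5 := S.l5 _ w5
          have k5 := S.l0 _ w0
          have := S.hsum [(m,0),(m+1,1),(m+2,1),(m+3,3),(m+4,3),(m+4,0),(m+4,1),(m+5,4),(m+5,5),
            (m+2,0)] (by simp)
          simp at this
          omega
      · have hfy : ¬ s (m+3+1) (P.fy (m+3+1)) := by rw [fy4]; exact t
        have t4 := (S.r1 (m+3) (by omega) u3).resolve_right hfy
        have tx := (S.r9 (m+3) t4).2.resolve_right hfy
        have k2 := S.lfx _ (by omega) tx
        have k3 : 1 ≤ c (m+4) 4 := S.l4 _ t4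
        by_cases w : s (m+5) 2
        · have l2 := S.l2 _ w
          have w4 := (S.r6 (m+4) (by rw [fy5]; exact w)).resolve_right t
          have w1 := (S.r9 (m+4) w4).1.resolve_left t
          have k4 : 1 ≤ c (m+5) 4 := S.l4 _ w4
          have k5 : P.x (m+5) ≤ c (m+5) 1 + P.pp (m+5) := S.l1 _ w1
          have := S.hsum [(m,0),(m+1,1),(m+2,1),(m+3,3),(m+3,0),(m+3,1),(m+4,4),(m+5,4),(m+5,1),
            (m+5,2)] (by simp)
          simp at this
          omega
        · have w5 : s (m+5) 5 := (S.r7 (m+2) a2 v2).resolve_right w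
          have w0 := (S.r10 (m+2) w5).1.resolve_right w
          have k4 : 1 ≤ c (m+5) 5 := S.l5 _ w5
          have k5 := S.l0 _ w0
          have k6 : P.a (m+3) ≤ c (m+6) 5 + c (m+6) 3 := by
            by_cases a3 : P.a (m+3) = 1
            · rw [fx, if_pos a3] at tx
              rcases S.r3 _ tx with e | e
              · have : 1 ≤ c (m+6) 5 := S.l5 _ e
                omega
              · have : 1 ≤ c (m+6) 3 := S.pos3 _ e
                omega
            · have := P.ha1 (m+3); omega
          have := S.hsum [(m,0),(m+1,1),(m+2,1),(m+3,3),(m+3,0),(m+3,1),(m+4,4),(m+5,5),(m+2,0),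
            (m+6,5),(m+6,3)] (by simp)
          simp at this
          omega
    · have w4 : s (m+2) 4 := (S.r5 (m+1) (by omega) (by rw [fx1]; exact v1)).resolve_right v2
      have w3 := (S.r9 (m+1) w4).1.resolve_right v2
      have hy := S.fully (m+1) (fun _ => ⟨hlow _ _ (by omega) (by omega),
        hlow _ _ (by omega) (by omega)⟩) (Or.inr w3)
      have k4 := S.l4 _ w4
      have hd := P.hdeg (m+1) (by omega)
      have hbd : (if 3 ≤ m+1 then P.a (m+1-3) else 0) = P.b (m+1) := rfl
      rw [hbd, if_pos (by omega), if_pos (by omega), a10] at hd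
      have := S.hsum [(m,0),(m+1,1),(m+1,2),(m+1,3),(m+1,5),(m+2,4)] (by simp)
      simp at this
      omega
  · have hf4 : m + 4 = P.f := by
      rcases G.nn m ha with h | h | h
      · exact (a1 h).elim
      · exact (a2 h).elim
      · exact h
    have hl := G.ll m ha hf4
    have a3 : ¬ P.a (m+3) = 1 := by
      intro h; have := P.ha _ h; omega
    have a30 : P.a (m+3) = 0 := by have := P.ha1 (m+3); omega
    have fx2 : P.fx (m+2) = 1 := by rw [fx, if_neg a2]
    have w1 := S.rl (m+3) (by omega) u3
    have lw := S.l1 _ w1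
    rw [pp, if_neg a3] at lw
    have k1 : 1 ≤ c (m+3) 4 + c (m+2) 1 := by
      rcases S.r2 (m+2) w1 with e | e
      · have : 1 ≤ c (m+3) 4 := S.l4 _ e
        omega
      · rw [fx2] at e
        have : 1 ≤ c (m+2) 1 := S.pos1 _ e
        omega
    have hd := P.hdeg (m+3) (by omega)
    have hbd : (if 3 ≤ m+3 then P.a (m+3-3) else 0) = P.b (m+3) := rfl
    rw [hbd, if_neg (by omega), if_pos (by omega), a30, hb3] at hd
    have := S.hsum [(m,0),(m+1,1),(m+3,3),(m+3,1),(m+3,4),(m+2,1)] (by simp)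
    simp at this
    omega

end Sg
end Par

namespace Par
open Vx
variable (P : Par)

def key : Vx → ℕ × ℕ
  | N i j => (i, if j < P.pp i then 0 else if j < P.x i then 1 else
      if j < P.x i + P.rr i then 2 else 3)
  | C i => (i+1, 4)
  | D i => (i+3, 5)

theorem b_split (i : ℕ) (h : P.b i = 1) : ∃ k, i = k + 3 ∧ P.a k = 1 := by
  unfold b at h
  split_ifs at h with h3
  exact ⟨i - 3, by omega, h⟩

theorem pp_lt (i : ℕ) (hi : i < P.f) : P.pp i < P.x i := by
  have := P.hx i hi
  unfold pp
  split_ifs with h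
  · have := P.ha i h; omega
  · omega

theorem rr_lt (i : ℕ) (hi : i < P.f) : P.rr i < P.y i := by
  have := P.hy i hi
  unfold rr
  split_ifs with h
  · obtain ⟨k, rfl, hk⟩ := P.b_split i h
    have := P.ha k hk; omega
  · omega

variable {P}
/-- closed set of vertices -/
structure Clo (P : Par) (U : Finset Vx) : Prop where
  V : ∀ u ∈ U, P.Valid u
  s : ∀ u ∈ U, ∃ v ∈ U, P.E u v
  p : ∀ u ∈ U, ∃ v ∈ U, P.E v u

namespace Clo
variable {U : Finset Vx}

theorem succN (K : Clo P U) {i j : ℕ} (h : N i j ∈ U) :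
    (j + 1 < P.x i + P.y i ∧ (j + 1 = P.x i → i = 0) ∧ N i (j+1) ∈ U ∧
      (P.a i = 1 → j + 1 ≠ P.p i) ∧ (P.b i = 1 → j + 1 ≠ P.x i + P.r i)) ∨
    (i + 1 = P.f ∧ j + 1 = P.x i + P.y i ∧ N i 0 ∈ U) ∨
    (i + 1 < P.f ∧ j + 1 = P.x i + P.y i ∧ (C i ∈ U ∨ N (i+1) (P.x (i+1)) ∈ U)) ∨
    (∃ k, i = k + 1 ∧ j + 1 = P.x i ∧ (C k ∈ U ∨ N k 0 ∈ U)) ∨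
    (P.a i = 1 ∧ j + 1 = P.p i ∧ (D i ∈ U ∨ N (i+3) (P.x (i+3) + P.r (i+3)) ∈ U)) ∨
    (∃ k, i = k + 3 ∧ P.a k = 1 ∧ j + 1 = P.x i + P.r i ∧ (D k ∈ U ∨ N k (P.p k) ∈ U)) := by
  obtain ⟨v, hv, hE⟩ := K.s _ h
  cases hE with
  | st _ _ hi hj h1 h2 h3 =>
    refine Or.inl ⟨hj, h1, hv, h2, ?_⟩
    intro hb
    obtain ⟨k, rfl, hk⟩ := P.b_split i hb
    exact h3 (by omega) hk
  | wr _ _ k hi hj hk => subst hk; exact Or.inr (Or.inl ⟨hi, hj, hv⟩)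
  | c1 _ _ hi hj => exact Or.inr (Or.inr (Or.inl ⟨hi, hj, Or.inl hv⟩))
  | c2 k _ _ hi e hj => exact Or.inr (Or.inr (Or.inr (Or.inl ⟨k, e, hj, Or.inl hv⟩)))
  | c5 _ i' _ k hi e hj hk =>
    subst e hk
    exact Or.inr (Or.inr (Or.inl ⟨hi, hj, Or.inr hv⟩))
  | c6 k _ _ z hi e hj hk =>
    subst hk
    exact Or.inr (Or.inr (Or.inr (Or.inl ⟨k, e, hj, Or.inr hv⟩)))
  | d1 _ _ hi hj => exact Or.inr (Or.inr (Or.inr (Or.inr (Or.inl ⟨hi, hj, Or.inl hv⟩))))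
  | d2 k _ _ hi e hj =>
    exact Or.inr (Or.inr (Or.inr (Or.inr (Or.inr ⟨k, e, hi, hj, Or.inl hv⟩))))
  | d5 _ i' _ k hi e hj hk =>
    subst e hk
    exact Or.inr (Or.inr (Or.inr (Or.inr (Or.inl ⟨hi, hj, Or.inr hv⟩))))
  | d6 k _ _ z hi e hj hk =>
    subst hk
    exact Or.inr (Or.inr (Or.inr (Or.inr (Or.inr ⟨k, e, hi, hj, Or.inr hv⟩))))

theorem predN (K : Clo P U) {i j : ℕ} (h : N i j ∈ U) :
    (1 ≤ j ∧ (j = P.x i → i = 0) ∧ N i (j-1) ∈ U ∧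
      (P.a i = 1 → j ≠ P.p i) ∧ (P.b i = 1 → j ≠ P.x i + P.r i)) ∨
    (i + 1 = P.f ∧ j = 0 ∧ N i (P.x i + P.y i - 1) ∈ U) ∨
    (i + 1 < P.f ∧ j = 0 ∧ (C i ∈ U ∨ N (i+1) (P.x (i+1) - 1) ∈ U)) ∨
    (∃ k, i = k + 1 ∧ j = P.x i ∧ (C k ∈ U ∨ N k (P.x k + P.y k - 1) ∈ U)) ∨
    (P.a i = 1 ∧ j = P.p i ∧ (D i ∈ U ∨ N (i+3) (P.x (i+3) + P.r (i+3) - 1) ∈ U)) ∨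
    (∃ k, i = k + 3 ∧ P.a k = 1 ∧ j = P.x i + P.r i ∧ (D k ∈ U ∨ N k (P.p k - 1) ∈ U)) := by
  obtain ⟨v, hv, hE⟩ := K.p _ h
  cases hE with
  | st _ j hi hj h1 h2 h3 =>
    refine Or.inl ⟨by omega, h1, hv, h2, ?_⟩
    intro hb
    obtain ⟨k, rfl, hk⟩ := P.b_split i hb
    exact h3 (by omega) hk
  | wr _ j k hi hj hk =>
    rw [← hj]
    exact Or.inr (Or.inl ⟨hi, hk, hv⟩)
  | c3 _ _ hi hk => exact Or.inr (Or.inr (Or.inl ⟨hi, hk, Or.inl hv⟩))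
  | c4 k _ _ hi e hj => exact Or.inr (Or.inr (Or.inr (Or.inl ⟨k, e, hj, Or.inl hv⟩)))
  | c5 k _ j _ hi e hj hk =>
    refine Or.inr (Or.inr (Or.inr (Or.inl ⟨k, e, hk, Or.inr ?_⟩)))
    rw [← hj]; exact hv
  | c6 _ i' j _ hi e hj hk =>
    subst e
    refine Or.inr (Or.inr (Or.inl ⟨hi, hk, Or.inr ?_⟩))
    rw [← hj]; exact hv
  | d3 _ _ hi hk => exact Or.inr (Or.inr (Or.inr (Or.inr (Or.inl ⟨hi, hk, Or.inl hv⟩))))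
  | d4 k _ _ hi e hk =>
    exact Or.inr (Or.inr (Or.inr (Or.inr (Or.inr ⟨k, e, hi, hk, Or.inl hv⟩))))
  | d5 k _ j _ hi e hj hk =>
    refine Or.inr (Or.inr (Or.inr (Or.inr (Or.inr ⟨k, e, hi, hk, Or.inr ?_⟩))))
    rw [← hj]; exact hv
  | d6 _ i' j _ hi e hj hk =>
    subst e
    refine Or.inr (Or.inr (Or.inr (Or.inr (Or.inl ⟨hi, hk, Or.inr ?_⟩))))
    rw [← hj]; exact hv

/-- no segment starts strictly between `lo` and `hi` -/
def NB (P : Par) (i lo hi : ℕ) : Prop := ∀ t, lo < t → t < hi →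
    t ≠ P.x i ∧ (P.a i = 1 → t ≠ P.p i) ∧ (P.b i = 1 → t ≠ P.x i + P.r i)

theorem seg (K : Clo P U) {i lo hi : ℕ} (hb : NB P i lo hi) (hn : hi ≤ P.x i + P.y i)
    {j k : ℕ} (h : N i j ∈ U) (h1 : lo ≤ j) (h2 : j < hi) (h3 : lo ≤ k) (h4 : k < hi) :
    N i k ∈ U := by
  have fw : ∀ d j, N i j ∈ U → lo ≤ j → j + d < hi → N i (j+d) ∈ U := by
    intro d
    induction d with
    | zero => intro j h _ _; exact h
    | succ d ih =>
      intro j h h1 h2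
      have hj := hb (j+d+1) (by omega) (by omega)
      rcases K.succN (ih j h h1 (by omega)) with h' | h' | h' | ⟨k, h'⟩ | h' | ⟨k, e, hk, h'⟩
      · exact h'.2.2.1
      · omega
      · omega
      · omega
      · exact (hj.2.1 h'.1 h'.2.1).elim
      · refine (hj.2.2 ?_ h'.1).elim
        rw [e, P.b_add, hk]
  have bw : ∀ d j, N i (j+d) ∈ U → lo ≤ j → j + d < hi → N i j ∈ U := by
    intro d
    induction d with
    | zero => intro j h _ _; exact h
    | succ d ih =>
      intro j h h1 h2
      have hj := hb (j+d+1) (by omega) (by omega)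
      apply ih j _ h1 (by omega)
      rcases K.predN h with h' | h' | h' | ⟨k, h'⟩ | h' | ⟨k, e, hk, h'⟩
      · exact h'.2.2.1
      · omega
      · omega
      · omega
      · exact (hj.2.1 h'.1 h'.2.1).elim
      · refine (hj.2.2 ?_ h'.1).elim
        rw [e, P.b_add, hk]
  rcases le_total j k with hjk | hjk
  · obtain ⟨d, rfl⟩ := Nat.exists_eq_add_of_le hjk
    exact fw d j h h1 h4
  · obtain ⟨d, rfl⟩ := Nat.exists_eq_add_of_le hjk
    exact bw d k h h3 h2

def Sm (P : Par) (U : Finset Vx) (i k : ℕ) : Prop := ∃ v ∈ U, P.key v = (i, k)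

theorem toS0 {i j : ℕ} (h : N i j ∈ U) (hj : j < P.pp i) : Sm P U i 0 :=
  ⟨_, h, by simp only [key]; rw [if_pos hj]⟩
theorem toS1 {i j : ℕ} (h : N i j ∈ U) (h1 : P.pp i ≤ j) (h2 : j < P.x i) : Sm P U i 1 :=
  ⟨_, h, by simp only [key]; rw [if_neg (by omega), if_pos h2]⟩
theorem toS2 (K : Clo P U) {i j : ℕ} (h : N i j ∈ U) (h1 : P.x i ≤ j) (h2 : j < P.x i + P.rr i) :
    Sm P U i 2 := by
  have := P.pp_lt i (K.V _ h).1
  exact ⟨_, h, by simp only [key]; rw [if_neg (by omega), if_neg (by omega), if_pos h2]⟩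
theorem toS3 (K : Clo P U) {i j : ℕ} (h : N i j ∈ U) (h1 : P.x i + P.rr i ≤ j) :
    Sm P U i 3 := by
  have := P.pp_lt i (K.V _ h).1
  exact ⟨_, h, by simp only [key]; rw [if_neg (by omega), if_neg (by omega), if_neg (by omega)]⟩
theorem toC {i : ℕ} (h : C i ∈ U) : Sm P U (i+1) 4 := ⟨_, h, rfl⟩
theorem toD {i : ℕ} (h : D i ∈ U) : Sm P U (i+3) 5 := ⟨_, h, rfl⟩

theorem ofN {i k : ℕ} (hk : k ≤ 3) (h : Sm P U i k) :
    ∃ j, N i j ∈ U ∧ (k = 0 → j < P.pp i) ∧ (k = 1 → P.pp i ≤ j ∧ j < P.x i) ∧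
    (k = 2 → P.x i ≤ j ∧ j < P.x i + P.rr i) ∧ (k = 3 → P.x i + P.rr i ≤ j) := by
  obtain ⟨v, hv, e⟩ := h
  cases v with
  | C i' => simp only [key, Prod.mk.injEq] at e; omega
  | D i' => simp only [key, Prod.mk.injEq] at e; omega
  | N i' j =>
    simp only [key, Prod.mk.injEq] at e
    obtain ⟨rfl, e⟩ := e
    refine ⟨j, hv, ?_⟩
    split_ifs at e <;> refine ⟨?_, ?_, ?_, ?_⟩ <;> omega

theorem ofC {i : ℕ} (h : Sm P U (i+1) 4) : C i ∈ U := by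
  obtain ⟨v, hv, e⟩ := h
  cases v with
  | C i' =>
    simp only [key, Prod.mk.injEq] at e
    rwa [show i = i' by omega]
  | D i' => simp only [key, Prod.mk.injEq] at e; omega
  | N i' j =>
    simp only [key, Prod.mk.injEq] at e
    obtain ⟨rfl, e⟩ := e
    split_ifs at e <;> omega

theorem ofD {i : ℕ} (h : Sm P U (i+3) 5) : D i ∈ U := by
  obtain ⟨v, hv, e⟩ := h
  cases v with
  | D i' =>
    simp only [key, Prod.mk.injEq] at e
    rwa [show i = i' by omega]
  | C i' => simp only [key, Prod.mk.injEq] at e; omega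
  | N i' j =>
    simp only [key, Prod.mk.injEq] at e
    obtain ⟨rfl, e⟩ := e
    split_ifs at e <;> omega

theorem mem0 (K : Clo P U) {i : ℕ} (h : Sm P U i 0) : P.a i = 1 ∧ i < P.f ∧
    ∀ j, j < P.p i → N i j ∈ U := by
  obtain ⟨j, hj, h0, -⟩ := ofN (by omega) h
  have hj0 := h0 rfl
  have hf : i < P.f := (K.V _ hj).1
  unfold pp at hj0
  split_ifs at hj0 with ha
  · refine ⟨ha, hf, fun k hk => ?_⟩
    have := P.ha i ha
    exact K.seg (lo := 0) (hi := P.p i)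
      (fun t _ _ => ⟨by omega, fun _ => by omega, fun _ => by omega⟩)
      (by omega) hj (by omega) hj0 (by omega) hk
  · omega

theorem mem1 (K : Clo P U) {i : ℕ} (h : Sm P U i 1) : i < P.f ∧
    ∀ j, P.pp i ≤ j → j < P.x i → N i j ∈ U := by
  obtain ⟨j, hj, -, h0, -⟩ := ofN (by omega) h
  have hj0 := h0 rfl
  have hf : i < P.f := (K.V _ hj).1
  refine ⟨hf, fun k hk hk' => ?_⟩
  refine K.seg (lo := P.pp i) (hi := P.x i)
      (fun t h1 _ => ⟨by omega, fun ha => ?_, fun _ => by omega⟩)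
      (by omega) hj hj0.1 hj0.2 hk hk'
  rw [pp, if_pos ha] at h1
  omega

theorem mem2 (K : Clo P U) {i : ℕ} (h : Sm P U i 2) : P.b i = 1 ∧ i < P.f ∧
    ∀ j, P.x i ≤ j → j < P.x i + P.r i → N i j ∈ U := by
  obtain ⟨j, hj, -, -, h0, -⟩ := ofN (by omega) h
  have hj0 := h0 rfl
  have hf : i < P.f := (K.V _ hj).1
  have hr := P.rr_lt i hf
  unfold rr at hj0 hr
  split_ifs at hj0 hr with hb
  · refine ⟨hb, hf, fun k hk hk' => ?_⟩
    refine K.seg (lo := P.x i) (hi := P.x i + P.r i)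
      (fun t _ _ => ⟨by omega, fun ha => ?_, fun _ => by omega⟩)
      (by omega) hj (by omega) (by omega) (by omega) (by omega)
    have := P.ha i ha
    omega
  · omega

theorem mem3 (K : Clo P U) {i : ℕ} (h : Sm P U i 3) : i < P.f ∧
    ∀ j, P.x i + P.rr i ≤ j → j < P.x i + P.y i → N i j ∈ U := by
  obtain ⟨j, hj, -, -, -, h0⟩ := ofN (by omega) h
  have hj0 := h0 rfl
  have hf : i < P.f := (K.V _ hj).1
  refine ⟨hf, fun k hk hk' => ?_⟩
  have hV : j < P.x i + P.y i := (K.V _ hj).2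
  refine K.seg (lo := P.x i + P.rr i) (hi := P.x i + P.y i)
      (fun t h1 _ => ⟨by omega, fun ha => ?_, fun hb => ?_⟩)
      (by omega) hj hj0 hV hk hk'
  · have := P.ha i ha
    omega
  · rw [rr, if_pos hb] at h1
    omega

theorem lenl {i k lo hi : ℕ} (h : ∀ j, lo ≤ j → j < hi → N i j ∈ U ∧ P.key (N i j) = (i, k)) :
    hi - lo ≤ (U.filter (fun v => P.key v = (i, k))).card := by
  have : ((Finset.Ico lo hi).image (N i)) ⊆ U.filter (fun v => P.key v = (i, k)) := by
    intro v hv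
    obtain ⟨j, hj, rfl⟩ := Finset.mem_image.1 hv
    rw [Finset.mem_Ico] at hj
    exact Finset.mem_filter.2 (h j hj.1 hj.2)
  have h2 := Finset.card_le_card this
  rw [Finset.card_image_of_injective _ (fun a b e => by simpa using e), Nat.card_Ico] at h2
  exact h2

theorem fxN (i : ℕ) (h : N i 0 ∈ U) (hf : i < P.f) : Sm P U i (P.fx i) := by
  have := P.hx i hf
  unfold fx
  split_ifs with ha
  · have := P.ha i ha
    exact toS0 h (by rw [pp, if_pos ha]; omega)
  · exact toS1 h (by rw [pp, if_neg ha]) (by omega)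

theorem Nfx (K : Clo P U) (i : ℕ) (h : Sm P U i (P.fx i)) : N i 0 ∈ U := by
  unfold fx at h
  split_ifs at h with ha
  · have := P.ha i ha
    exact (K.mem0 h).2.2 0 (by omega)
  · have h1 := K.mem1 h
    have := P.hx i h1.1
    exact h1.2 0 (by rw [pp, if_neg ha]) (by omega)

theorem fyN (K : Clo P U) (i : ℕ) (h : N i (P.x i) ∈ U) : Sm P U i (P.fy i) := by
  unfold fy
  split_ifs with hb
  · obtain ⟨k, rfl, hk⟩ := P.b_split i hb
    have := P.ha k hk
    exact K.toS2 h (by omega) (by rw [rr, if_pos hb]; omega)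
  · exact K.toS3 h (by rw [rr, if_neg hb]; omega)

theorem Nfy (K : Clo P U) (i : ℕ) (h : Sm P U i (P.fy i)) : N i (P.x i) ∈ U := by
  unfold fy at h
  split_ifs at h with hb
  · obtain ⟨k, rfl, hk⟩ := P.b_split i hb
    have := P.ha k hk
    exact (K.mem2 h).2.2 _ (by omega) (by omega)
  · have h1 := K.mem3 h
    have := P.hy i h1.1
    exact h1.2 _ (by rw [rr, if_neg hb]; omega) (by omega)

theorem lastX (i : ℕ) (h : N i (P.x i - 1) ∈ U) (hf : i < P.f) : Sm P U i 1 := by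
  have := P.pp_lt i hf
  exact toS1 h (by omega) (by omega)
theorem Xlast (K : Clo P U) (i : ℕ) (h : Sm P U i 1) : N i (P.x i - 1) ∈ U := by
  have h1 := K.mem1 h
  have := P.pp_lt i h1.1
  exact h1.2 _ (by omega) (by omega)
theorem lastY (K : Clo P U) (i : ℕ) (h : N i (P.x i + P.y i - 1) ∈ U) : Sm P U i 3 := by
  have := P.rr_lt i (K.V _ h).1
  exact K.toS3 h (by omega)
theorem Ylast (K : Clo P U) (i : ℕ) (h : Sm P U i 3) : N i (P.x i + P.y i - 1) ∈ U := by
  have h1 := K.mem3 h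
  have := P.rr_lt i h1.1
  exact h1.2 _ (by omega) (by omega)

end Clo
end Par

namespace Par
open Vx
variable {P : Par}
namespace Clo
variable {U : Finset Vx}

theorem atC (K : Clo P U) (i : ℕ) (h : C i ∈ U) : i + 1 < P.f ∧
    (N i (P.x i + P.y i - 1) ∈ U ∨ N (i+1) (P.x (i+1) - 1) ∈ U) ∧
    (N i 0 ∈ U ∨ N (i+1) (P.x (i+1)) ∈ U) := by
  refine ⟨K.V _ h, ?_, ?_⟩
  · obtain ⟨v, hv, hE⟩ := K.p _ h
    cases hE with
    | c1 _ j hi hj => left; rw [← hj]; exact hv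
    | c2 _ i' j hi e hj => subst e; right; rw [← hj]; exact hv
  · obtain ⟨v, hv, hE⟩ := K.s _ h
    cases hE with
    | c3 _ k hi hk => subst hk; exact Or.inl hv
    | c4 _ i' k hi e hk => subst e hk; exact Or.inr hv

theorem atD (K : Clo P U) (i : ℕ) (h : D i ∈ U) : P.a i = 1 ∧
    (N i (P.p i - 1) ∈ U ∨ N (i+3) (P.x (i+3) + P.r (i+3) - 1) ∈ U) ∧
    (N i (P.p i) ∈ U ∨ N (i+3) (P.x (i+3) + P.r (i+3)) ∈ U) := by
  refine ⟨K.V _ h, ?_, ?_⟩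
  · obtain ⟨v, hv, hE⟩ := K.p _ h
    cases hE with
    | d1 _ j hi hj => left; rw [← hj]; exact hv
    | d2 _ i' j hi e hj => subst e; right; rw [← hj]; exact hv
  · obtain ⟨v, hv, hE⟩ := K.s _ h
    cases hE with
    | d3 _ k hi hk => subst hk; exact Or.inl hv
    | d4 _ i' k hi e hk => subst e hk; exact Or.inr hv

theorem pN1 {i : ℕ} (ha : P.a i = 1) (h : N i (P.p i) ∈ U) : Sm P U i 1 := by
  have := P.ha i ha
  exact toS1 h (by rw [pp, if_pos ha]) (by omega)
theorem pN0 {i : ℕ} (ha : P.a i = 1) (h : N i (P.p i - 1) ∈ U) : Sm P U i 0 := by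
  have := P.ha i ha
  exact toS0 h (by rw [pp, if_pos ha]; omega)
theorem rN2 (K : Clo P U) {i : ℕ} (ha : P.a i = 1)
    (h : N (i+3) (P.x (i+3) + P.r (i+3) - 1) ∈ U) : Sm P U (i+3) 2 := by
  have := P.ha i ha
  exact K.toS2 h (by omega) (by rw [rr, if_pos (by rw [P.b_add, ha])]; omega)
theorem rN3 (K : Clo P U) {i : ℕ} (ha : P.a i = 1)
    (h : N (i+3) (P.x (i+3) + P.r (i+3)) ∈ U) : Sm P U (i+3) 3 := by
  have := P.ha i ha
  exact K.toS3 h (by rw [rr, if_pos (by rw [P.b_add, ha])])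

/-- facts about the position of the marks of row `i` -/
theorem marks (i : ℕ) (hf : i < P.f) : 1 ≤ P.x i ∧ 1 ≤ P.y i ∧
    (P.a i = 1 → 1 ≤ P.p i ∧ P.p i < P.x i) ∧
    (∀ k, i = k + 3 → P.a k = 1 → 1 ≤ P.r i ∧ P.r i < P.y i) := by
  refine ⟨P.hx i hf, P.hy i hf, fun h => ?_, fun k hk h => ?_⟩
  · have := P.ha i h; omega
  · subst hk; have := P.ha k h; omega

theorem sg (K : Clo P U) (hne : U.Nonempty) :
    P.Sg (Sm P U) (fun i k => (U.filter (fun v => P.key v = (i, k))).card) U.card where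
  v0 i h := (K.mem0 h).1
  v2 i h := (K.mem2 h).1
  vf i k h hk := by
    obtain ⟨j, hj, -⟩ := ofN hk h
    exact (K.V _ hj).1
  r1 i hi h := by
    have hN := K.Ylast i h
    have M := marks (P := P) i (by omega)
    rcases K.succN hN with h' | h' | h' | ⟨k, h'⟩ | h' | ⟨k, e, hk, h'⟩
    · omega
    · omega
    · rcases h'.2.2 with h' | h'
      · exact Or.inl (toC h')
      · exact Or.inr (K.fyN _ h')
    · omega
    · have := M.2.2.1 h'.1; omega
    · have := M.2.2.2 k e hk; omega
  r2 i h := by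
    have hN := K.Xlast _ h
    have hV := K.V _ hN
    have M := marks (P := P) (i+1) hV.1
    rcases K.succN hN with h' | h' | h' | ⟨k, h'⟩ | h' | ⟨k, e, hk, h'⟩
    · omega
    · omega
    · omega
    · obtain rfl : i = k := by omega
      rcases h'.2.2 with h' | h'
      · exact Or.inl (toC h')
      · exact Or.inr (fxN _ h' (K.V _ h').1)
    · have := M.2.2.1 h'.1; omega
    · have := M.2.2.2 k e hk; omega
  r2z h := by
    have hN := K.Xlast _ h
    have hV := K.V _ hN
    have M := marks (P := P) 0 hV.1
    rcases K.succN hN with h' | h' | h' | ⟨k, h'⟩ | h' | ⟨k, e, hk, h'⟩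
    · exact K.toS3 h'.2.2.1 (by simp [rr, b]; omega)
    · omega
    · omega
    · omega
    · have := M.2.2.1 h'.1; omega
    · omega
  r3 i h := by
    obtain ⟨ha, hf, hm⟩ := K.mem0 h
    have M := marks (P := P) i hf
    have M3 := M.2.2.1 ha
    have hN := hm (P.p i - 1) (by omega)
    rcases K.succN hN with h' | h' | h' | ⟨k, h'⟩ | h' | ⟨k, e, hk, h'⟩
    · have := h'.2.2.2.1 ha; omega
    · omega
    · omega
    · omega
    · rcases h'.2.2 with h' | h'
      · exact Or.inl (toD h')
      · exact Or.inr (K.rN3 ha h')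
    · omega
  r4 i h := by
    obtain ⟨hb, hf, hm⟩ := K.mem2 h
    have ha : P.a i = 1 := by rwa [P.b_add] at hb
    have M := marks (P := P) (i+3) hf
    have M3 := M.2.2.2 i rfl ha
    have hN := hm (P.x (i+3) + P.r (i+3) - 1) (by omega) (by omega)
    rcases K.succN hN with h' | h' | h' | ⟨k, h'⟩ | h' | ⟨k, e, hk, h'⟩
    · have := h'.2.2.2.2 hb; omega
    · omega
    · omega
    · omega
    · have := M.2.2.1 h'.1; omega
    · obtain rfl : i = k := by omega
      rcases h'.2 with h' | h'
      · exact Or.inl (toD h')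
      · exact Or.inr (pN1 ha h')
  r5 i hi h := by
    have hN := K.Nfx _ h
    have M := marks (P := P) i (by omega)
    rcases K.predN hN with h' | h' | h' | ⟨k, h'⟩ | h' | ⟨k, e, hk, h'⟩
    · omega
    · omega
    · rcases h'.2.2 with h' | h'
      · exact Or.inl (toC h')
      · exact Or.inr (lastX _ h' (by omega))
    · omega
    · have := M.2.2.1 h'.1; omega
    · omega
  r6 i h := by
    have hN := K.Nfy _ h
    have M := marks (P := P) (i+1) (K.V _ hN).1
    rcases K.predN hN with h' | h' | h' | ⟨k, h'⟩ | h' | ⟨k, e, hk, h'⟩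
    · omega
    · omega
    · omega
    · obtain rfl : i = k := by omega
      rcases h'.2.2 with h' | h'
      · exact Or.inl (toC h')
      · exact Or.inr (K.lastY _ h')
    · have := M.2.2.1 h'.1; omega
    · have := M.2.2.2 k e hk; omega
  r6z h := by
    have hb : P.b 0 = 0 := by simp [b]
    have hN := K.Nfy 0 (by rw [fy, if_neg (by omega)]; exact h)
    have M := marks (P := P) 0 (K.V _ hN).1
    rcases K.predN hN with h' | h' | h' | ⟨k, h'⟩ | h' | ⟨k, e, hk, h'⟩
    · exact lastX _ h'.2.2.1 (K.V _ hN).1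
    · omega
    · omega
    · omega
    · have := M.2.2.1 h'.1; omega
    · omega
  r7 i ha h := by
    obtain ⟨hf, hm⟩ := K.mem1 h
    have M := marks (P := P) i hf
    have M3 := M.2.2.1 ha
    have hN := hm (P.p i) (by rw [pp, if_pos ha]) (by omega)
    rcases K.predN hN with h' | h' | h' | ⟨k, h'⟩ | h' | ⟨k, e, hk, h'⟩
    · exact (h'.2.2.2.1 ha rfl).elim
    · omega
    · omega
    · omega
    · rcases h'.2.2 with h' | h'
      · exact Or.inl (toD h')
      · exact Or.inr (K.rN2 ha h')
    · omega
  r8 i ha h := by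
    have hb : P.b (i+3) = 1 := by rw [P.b_add, ha]
    obtain ⟨hf, hm⟩ := K.mem3 h
    have M := marks (P := P) (i+3) hf
    have M3 := M.2.2.2 i rfl ha
    have hN := hm (P.x (i+3) + P.r (i+3)) (by rw [rr, if_pos hb]) (by omega)
    rcases K.predN hN with h' | h' | h' | ⟨k, h'⟩ | h' | ⟨k, e, hk, h'⟩
    · exact (h'.2.2.2.2 hb rfl).elim
    · omega
    · omega
    · omega
    · have := M.2.2.1 h'.1; omega
    · obtain rfl : i = k := by omega
      rcases h'.2 with h' | h'
      · exact Or.inl (toD h')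
      · exact Or.inr (pN0 ha h')
  r9 i h := by
    obtain ⟨h1, h2, h3⟩ := K.atC i (ofC h)
    refine ⟨?_, ?_⟩
    · rcases h2 with h2 | h2
      · exact Or.inl (K.lastY _ h2)
      · exact Or.inr (lastX _ h2 h1)
    · rcases h3 with h2 | h2
      · exact Or.inl (fxN _ h2 (by omega))
      · exact Or.inr (K.fyN _ h2)
  r10 i h := by
    obtain ⟨h1, h2, h3⟩ := K.atD i (ofD h)
    refine ⟨?_, ?_⟩
    · rcases h2 with h2 | h2
      · exact Or.inl (pN0 h1 h2)
      · exact Or.inr (K.rN2 h1 h2)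
    · rcases h3 with h2 | h2
      · exact Or.inl (pN1 h1 h2)
      · exact Or.inr (K.rN3 h1 h2)
  rl i hi h := by
    have hN := K.Ylast i h
    have M := marks (P := P) i (by omega)
    have ha : P.a i ≠ 1 := by intro h0; have h00 := P.ha i h0; omega
    rcases K.succN hN with h' | h' | h' | ⟨k, h'⟩ | h' | ⟨k, e, hk, h'⟩
    · omega
    · have := fxN (P := P) (U := U) i h'.2.2 (by omega)
      rwa [fx, if_neg ha] at this
    · omega
    · omega
    · exact (ha h'.1).elim
    · have := M.2.2.2 k e hk; omega
  l0 i h := by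
    obtain ⟨h1, h2, h3⟩ := K.mem0 h
    have := lenl (P := P) (U := U) (i := i) (k := 0) (lo := 0) (hi := P.p i)
      (fun j _ hj => ⟨h3 j hj, by simp only [key]; rw [if_pos (by rw [pp, if_pos h1]; exact hj)]⟩)
    simpa using this
  l1 i h := by
    obtain ⟨h2, h3⟩ := K.mem1 h
    have := lenl (P := P) (U := U) (i := i) (k := 1) (lo := P.pp i) (hi := P.x i)
      (fun j hj hj' => ⟨h3 j hj hj', by
        simp only [key]; rw [if_neg (by omega), if_pos hj']⟩)
    omega
  l2 i h := by
    obtain ⟨h1, h2, h3⟩ := K.mem2 h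
    have hr : P.rr i = P.r i := by rw [rr, if_pos h1]
    have := P.pp_lt i h2
    have := lenl (P := P) (U := U) (i := i) (k := 2) (lo := P.x i) (hi := P.x i + P.r i)
      (fun j hj hj' => ⟨h3 j hj hj', by
        simp only [key]; rw [if_neg (by omega), if_neg (by omega), if_pos (by omega)]⟩)
    omega
  l3 i h := by
    obtain ⟨h2, h3⟩ := K.mem3 h
    have := P.pp_lt i h2
    have := lenl (P := P) (U := U) (i := i) (k := 3) (lo := P.x i + P.rr i) (hi := P.x i + P.y i)
      (fun j hj hj' => ⟨h3 j hj hj', by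
        simp only [key]; rw [if_neg (by omega), if_neg (by omega), if_neg (by omega)]⟩)
    omega
  l4 i h := by
    obtain ⟨v, hv, e⟩ := h
    exact Finset.card_pos.2 ⟨v, Finset.mem_filter.2 ⟨hv, e⟩⟩
  l5 i h := by
    obtain ⟨v, hv, e⟩ := h
    exact Finset.card_pos.2 ⟨v, Finset.mem_filter.2 ⟨hv, e⟩⟩
  hne := by
    have hN : ∀ i j, N i j ∈ U → ∃ i k, k ≤ 3 ∧ Sm P U i k := by
      intro i j h
      exact ⟨i, (P.key (N i j)).2, by simp only [key]; split_ifs <;> omega, N i j, h, rfl⟩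
    obtain ⟨v, hv⟩ := hne
    cases v with
    | N i j => exact hN i j hv
    | C i =>
      rcases (K.atC i hv).2.1 with h | h
      · exact hN _ _ h
      · exact hN _ _ h
    | D i =>
      rcases (K.atD i hv).2.1 with h | h
      · exact hN _ _ h
      · exact hN _ _ h
  hsum L hL := by
    have h1 : (L.map (fun k => (U.filter (fun v => P.key v = (k.1, k.2))).card)).sum =
        ∑ k ∈ L.toFinset, (U.filter (fun v => P.key v = k)).card := by
      rw [List.sum_toFinset _ hL]
    rw [h1]
    have h2 : ∑ k ∈ L.toFinset, (U.filter (fun v => P.key v = k)).card =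
        (L.toFinset.biUnion (fun k => U.filter (fun v => P.key v = k))).card := by
      rw [Finset.card_biUnion]
      intro a _ b _ hab
      show Disjoint _ _
      rw [Finset.disjoint_left]
      intro v hv hv'
      rw [Finset.mem_filter] at hv hv'
      exact hab (hv.2.symm.trans hv'.2)
    rw [h2]
    apply Finset.card_le_card
    intro v hv
    obtain ⟨k, _, hk⟩ := Finset.mem_biUnion.1 hv
    exact (Finset.mem_filter.1 hk).1

end Clo

theorem girth_lower (G : P.Good) (l : List P.H.V) (h : P.H.IsDicycle l) : P.g ≤ l.length := by
  obtain ⟨U, h1, h2, h3, h4, h5, h6⟩ := P.cyc_set h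
  rw [← h1]
  exact (Clo.sg ⟨h3, h4, h5⟩ h2).bound G

theorem hasDigirth (G : P.Good) : P.H.HasDigirth P.g := by
  classical
  refine ⟨?_, fun l h => girth_lower G l h⟩
  set U0 : Finset Vx := (Finset.range (P.x 0 + P.y 0)).image (N 0) ∪
    ({C 0} ∪ (if P.a 0 = 1 then {D 0} else ∅)) with hU0
  have hf := P.hf
  have hx0 := P.hx 0 (by omega)
  have hy0 := P.hy 0 (by omega)
  have hcard : U0.card ≤ P.g := by
    have hd := P.hdeg 0 (by omega)
    rw [if_pos (by omega), if_neg (by omega), if_neg (by omega)] at hd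
    have c1 := Finset.card_union_le ((Finset.range (P.x 0 + P.y 0)).image (N 0))
      ({C 0} ∪ (if P.a 0 = 1 then {D 0} else ∅))
    have c2 := Finset.card_union_le {C 0} (if P.a 0 = 1 then {D 0} else (∅ : Finset Vx))
    have c3 := Finset.card_image_le (s := Finset.range (P.x 0 + P.y 0)) (f := N 0)
    rw [Finset.card_range] at c3
    rw [Finset.card_singleton] at c2
    have c4 : (if P.a 0 = 1 then {D 0} else (∅ : Finset Vx)).card ≤ P.a 0 := by
      split_ifs with h
      · rw [h]; simp
      · simp
    rw [← hU0] at c1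
    omega
  have mN : ∀ j, j < P.x 0 + P.y 0 → N 0 j ∈ U0 := by
    intro j hj
    exact Finset.mem_union_left _ (Finset.mem_image_of_mem _ (Finset.mem_range.2 hj))
  have mC : C 0 ∈ U0 := by simp [hU0]
  have mD : P.a 0 = 1 → D 0 ∈ U0 := by intro h; simp [hU0, h]
  have TC : P.T (C 0) := ⟨trivial, by simp only [Valid]; omega⟩
  obtain ⟨l, hl, hlU⟩ := exists_dicycle P.H {v | v.1 ∈ U0}
    ⟨⟨C 0, (P.mem_vs _).2 TC.2⟩, mC⟩ (by
    suffices H : ∀ u ∈ U0, ∃ v ∈ U0, P.Arc u v by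
      intro u hu
      obtain ⟨v, hv, hA⟩ := H u.1 hu
      exact ⟨⟨v, (P.mem_vs _).2 (P.arc_valid hA).2⟩, hv, hA⟩
    intro u hu
    rw [hU0] at hu
    rcases Finset.mem_union.1 hu with hu | hu
    · obtain ⟨j, hj, rfl⟩ := Finset.mem_image.1 hu
      rw [Finset.mem_range] at hj
      by_cases h1 : j + 1 = P.x 0 + P.y 0
      · have := Arc.i1 (P := P) (C 0) TC
        simp only [m1] at this
        rw [← h1] at this
        exact ⟨_, mC, this⟩
      by_cases h2 : P.a 0 = 1 ∧ j + 1 = P.p 0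
      · have := Arc.i1 (P := P) (D 0) ⟨trivial, h2.1⟩
        simp only [m1] at this
        rw [← h2.2] at this
        exact ⟨_, mD h2.1, this⟩
      refine ⟨P.nx (N 0 j), ?_, Arc.pl _ (fun h => h) ⟨by omega, hj⟩ ?_⟩
      · simp only [nx]
        rw [if_neg h1]
        exact mN _ (by omega)
      · rintro (⟨i, k⟩ | i | i) ⟨hT, hV⟩
        · exact hT.elim
        · simp only [m1, m2, ne_eq, N.injEq]
          refine ⟨?_, by omega⟩
          rintro ⟨rfl, h⟩
          omega
        · simp only [m1, m2, ne_eq, N.injEq]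
          refine ⟨?_, by omega⟩
          rintro ⟨rfl, h⟩
          have := P.ha 0 hV
          exact h2 ⟨hV, by omega⟩
    · rcases Finset.mem_union.1 hu with hu | hu
      · rw [Finset.mem_singleton] at hu
        subst hu
        have := Arc.o1 (P := P) (C 0) TC
        rw [P.nx_m1_C 0 (by omega)] at this
        exact ⟨_, mN 0 (by omega), this⟩
      · split_ifs at hu with h
        · rw [Finset.mem_singleton] at hu
          subst hu
          have := Arc.o1 (P := P) (D 0) ⟨trivial, h⟩
          rw [P.nx_m1_D 0 h] at this
          have ha := P.ha 0 h
          exact ⟨_, mN _ (by omega), this⟩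
        · simp at hu)
  refine ⟨l, hl, le_antisymm ?_ (girth_lower G l hl)⟩
  obtain ⟨U, h1, h2, h3, h4, h5, h6⟩ := P.cyc_set hl
  rw [← h1]
  refine le_trans (Finset.card_le_card ?_) hcard
  intro u hu
  exact hlU _ (h6 ⟨u, (P.mem_vs _).2 (h3 u hu)⟩ hu)

end Par

namespace Par
open Vx
variable (P : Par)

def BB : ℕ := 2 * P.g + 5

def blk : Vx → ℕ
  | N i _ => i
  | C i => i
  | D i => i

def off : Vx → ℕ
  | N i j => if j < P.x i then 2 * (P.x i - 1 - j) else 2 * j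
  | C i => 2 * (P.x i + P.y i)
  | D i => 2 * (P.x i - 1 - P.p i) + 1

def ps (v : Vx) : ℕ := blk v * P.BB + P.off v + 1

theorem n_lt {i : ℕ} (h : i < P.f) : 2 * (P.x i + P.y i) + 5 ≤ P.BB := by
  have := P.hdeg i h
  unfold BB
  omega

theorem off_lt {v : Vx} (h : P.Valid v) : P.off v < P.BB := by
  cases v with
  | N i j =>
    have := P.n_lt h.1
    have := h.2
    simp only [off]; split_ifs <;> omega
  | C i =>
    have h : i + 1 < P.f := h
    have := P.n_lt (i := i) (by omega)
    simp only [off]; omega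
  | D i =>
    have h := P.ha i h
    have := P.n_lt (i := i) (by omega)
    simp only [off]; omega

theorem lex {i i' B : ℕ} (h : i < i') : i * B + B ≤ i' * B := by
  calc i * B + B = (i+1) * B := by ring
    _ ≤ i' * B := Nat.mul_le_mul_right _ h

theorem ps_inj {u v : Vx} (hu : P.Valid u) (hv : P.Valid v) (h : P.ps u = P.ps v) : u = v := by
  have h1 := P.off_lt hu
  have h2 := P.off_lt hv
  unfold ps at h
  have hb : blk u = blk v := by
    rcases lt_trichotomy (blk u) (blk v) with h' | h' | h'
    · have := lex (B := P.BB) h'; omega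
    · exact h'
    · have := lex (B := P.BB) h'; omega
  rw [hb] at h
  have ho : P.off u = P.off v := by omega
  clear h h1 h2
  cases u with
  | N i j =>
    cases v with
    | N i' j' =>
      simp only [blk] at hb
      subst hb
      simp only [off] at ho
      have : j = j' := by split_ifs at ho <;> omega
      rw [this]
    | C i' =>
      simp only [blk] at hb
      subst hb
      have := hu.2
      simp only [off] at ho
      split_ifs at ho <;> omega
    | D i' =>
      simp only [blk] at hb
      subst hb
      simp only [off] at ho
      split_ifs at ho <;> omega
  | C i =>
    cases v with
    | N i' j' =>
      simp only [blk] at hb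
      subst hb
      have := hv.2
      simp only [off] at ho
      split_ifs at ho <;> omega
    | C i' => simp only [blk] at hb; rw [hb]
    | D i' => simp only [off] at ho; omega
  | D i =>
    cases v with
    | N i' j' =>
      simp only [off] at ho
      split_ifs at ho <;> omega
    | C i' => simp only [off] at ho; omega
    | D i' => simp only [blk] at hb; rw [hb]

open Classical in
noncomputable def kd (u v : Vx) : Kd :=
  if blk u + 3 = blk v then Kd.lf else if blk v + 3 = blk u then Kd.lb
  else if P.ps v < P.ps u then Kd.top else Kd.bot

/-- Upper intervals. -/
def TI (i lo hi : ℕ) : Prop :=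
  (lo < hi ∧ hi ≤ 2 * (P.x i - 1) ∧ hi ≤ lo + 2 ∧ (lo % 2 = 0 ∨ hi = lo + 1) ∧
    (P.a i = 1 → hi = lo + 1 ∨ lo ≠ 2 * (P.x i - 1 - P.p i))) ∨
  (lo = 2 * (P.x i - 1) ∧ (hi = P.BB ∨ hi = 2 * (P.x i + P.y i) ∨
    (hi = 2 * (P.x i + P.y i - 1) ∧ i + 1 = P.f))) ∨
  (lo = 2 * (P.x i + P.y i) ∧ hi = P.BB)

/-- Lower intervals. -/
def BI (i lo hi : ℕ) : Prop :=
  (lo % 2 = 0 ∧ hi = lo + 2 ∧ 2 * P.x i ≤ lo ∧ hi ≤ 2 * (P.x i + P.y i)) ∨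
  (i + 1 < P.f ∧ lo = 2 * (P.x i + P.y i) ∧ hi = P.BB + 2 * P.x (i+1)) ∨
  (i + 1 < P.f ∧ lo = 2 * (P.x i + P.y i - 1) ∧ hi = P.BB + 2 * P.x (i+1)) ∨
  (i = 0 ∧ lo = 0 ∧ hi = 2 * P.x 0)

/-- Loops. -/
def LI (i α β : ℕ) (t : Prop) : Prop := P.a i = 1 ∧
  ((t ∧ β = 2 * (P.x (i+3) + P.r (i+3)) ∧
      (α = 2 * (P.x i - 1 - P.p i) + 1 ∨ α = 2 * (P.x i - 1 - P.p i) + 2)) ∨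
   (¬ t ∧ β + 2 = 2 * (P.x (i+3) + P.r (i+3)) ∧
      (α = 2 * (P.x i - 1 - P.p i) + 1 ∨ α = 2 * (P.x i - 1 - P.p i))))

def Cls (u v : Vx) : Prop :=
  (P.kd u v = Kd.top ∧ ∃ i lo hi, i < P.f ∧ P.TI i lo hi ∧ P.ps v = i * P.BB + lo + 1 ∧
    P.ps u = i * P.BB + hi + 1) ∨
  (P.kd u v = Kd.bot ∧ ∃ i lo hi, i < P.f ∧ P.BI i lo hi ∧ P.ps u = i * P.BB + lo + 1 ∧
    P.ps v = i * P.BB + hi + 1) ∨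
  (P.kd u v = Kd.lf ∧ ∃ i α β, P.LI i α β True ∧ P.ps u = i * P.BB + α + 1 ∧
    P.ps v = (i+3) * P.BB + β + 1) ∨
  (P.kd u v = Kd.lb ∧ ∃ i α β, P.LI i α β False ∧ P.ps v = i * P.BB + α + 1 ∧
    P.ps u = (i+3) * P.BB + β + 1)

theorem cls_top {u v : Vx} {i lo hi : ℕ} (h1 : blk u = i ∨ blk u = i + 1)
    (h2 : blk v = i ∨ blk v = i + 1) (hif : i < P.f) (hlt : lo < hi) (h : P.TI i lo hi)
    (hv : P.ps v = i * P.BB + lo + 1) (hu : P.ps u = i * P.BB + hi + 1) : P.Cls u v := by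
  refine Or.inl ⟨?_, i, lo, _, hif, h, hv, hu⟩
  unfold kd
  rw [if_neg (by omega), if_neg (by omega), if_pos (by omega)]

theorem cls_bot {u v : Vx} {i lo hi : ℕ} (h1 : blk u = i ∨ blk u = i + 1)
    (h2 : blk v = i ∨ blk v = i + 1) (hif : i < P.f) (hlt : lo < hi) (h : P.BI i lo hi)
    (hu : P.ps u = i * P.BB + lo + 1) (hv : P.ps v = i * P.BB + hi + 1) : P.Cls u v := by
  refine Or.inr (Or.inl ⟨?_, i, lo, _, hif, h, hu, hv⟩)
  unfold kd
  rw [if_neg (by omega), if_neg (by omega), if_neg (by omega)]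

theorem cls_lf {u v : Vx} {i α β : ℕ} (h1 : blk u = i)
    (h2 : blk v = i + 3) (h : P.LI i α β True)
    (hu : P.ps u = i * P.BB + α + 1) (hv : P.ps v = (i+3) * P.BB + β + 1) : P.Cls u v := by
  refine Or.inr (Or.inr (Or.inl ⟨?_, i, _, _, h, hu, hv⟩))
  unfold kd
  rw [if_pos (by omega)]

theorem cls_lb {u v : Vx} {i α β : ℕ} (h1 : blk v = i)
    (h2 : blk u = i + 3) (h : P.LI i α β False)
    (hu : P.ps v = i * P.BB + α + 1) (hv : P.ps u = (i+3) * P.BB + β + 1) : P.Cls u v := by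
  refine Or.inr (Or.inr (Or.inr ⟨?_, i, _, _, h, hu, hv⟩))
  unfold kd
  rw [if_neg (by omega), if_pos (by omega)]

theorem psx {i j : ℕ} (h : j < P.x i) : P.ps (N i j) = i * P.BB + 2 * (P.x i - 1 - j) + 1 := by
  simp only [ps, blk, off]; rw [if_pos h]

theorem psy {i j : ℕ} (h : P.x i ≤ j) : P.ps (N i j) = i * P.BB + 2 * j + 1 := by
  simp only [ps, blk, off]; rw [if_neg (by omega)]

theorem psC {i : ℕ} : P.ps (C i) = i * P.BB + 2 * (P.x i + P.y i) + 1 := rfl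

theorem psD {i : ℕ} : P.ps (D i) = i * P.BB + (2 * (P.x i - 1 - P.p i) + 1) + 1 := rfl

theorem cls {u v : Vx} (h : P.E u v) : P.Cls u v := by
  have hf := P.hf
  cases h with
  | st i j hi hj h1 h2 h3 =>
    have hx := P.hx i hi
    by_cases hjx : j + 1 < P.x i
    · refine P.cls_top (i := i) (lo := 2 * (P.x i - 1 - (j+1))) (hi := 2 * (P.x i - 1 - j))
        (Or.inl rfl) (Or.inl rfl) hi (by omega) (Or.inl ⟨by omega, by omega, by omega, by omega, fun hA => by
          have := h2 hA; have := P.ha i hA; omega⟩) (P.psx hjx) (P.psx (by omega))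
    · by_cases hjy : j + 1 = P.x i
      · have := h1 hjy
        subst this
        refine P.cls_bot (i := 0) (lo := 0) (hi := 2 * P.x 0)
          (Or.inl rfl) (Or.inl rfl) hi (by omega) (Or.inr (Or.inr (Or.inr (by omega)))) ?_ ?_
        · rw [P.psx (by omega)]; omega
        · rw [P.psy (by omega)]; omega
      · refine P.cls_bot (i := i) (lo := 2 * j) (hi := 2 * (j+1))
          (Or.inl rfl) (Or.inl rfl) hi (by omega) (Or.inl (by omega)) (P.psy (by omega))
          (P.psy (by omega))
  | wr i j k hi hj hk =>
    have hx := P.hx i (by omega)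
    have hy := P.hy i (by omega)
    subst hk
    refine P.cls_top (i := i) (lo := 2 * (P.x i - 1)) (hi := 2 * j)
        (Or.inl rfl) (Or.inl rfl) (by omega) (by omega) (Or.inr (Or.inl (by omega))) 
        (P.psx (by omega)) (P.psy (by omega))
  | c1 i j hi hj =>
    have hx := P.hx i (by omega)
    have hy := P.hy i (by omega)
    refine P.cls_bot (i := i) (lo := 2 * j) (hi := 2 * (P.x i + P.y i))
          (Or.inl rfl) (Or.inl rfl) (by omega) (by omega) (Or.inl (by omega)) (P.psy (by omega)) P.psC
  | c2 i i' j hi e hj =>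
    subst e
    have := P.n_lt (i := i) (by omega)
    refine P.cls_top (i := i) (lo := 2 * (P.x i + P.y i)) (hi := P.BB)
        (Or.inr rfl) (Or.inl rfl) (by omega) (by omega) (Or.inr (Or.inr (by omega))) 
        P.psC ?_
    rw [P.psx (by omega), add_mul]; omega
  | c3 i k hi hk =>
    subst hk
    have hx := P.hx i (by omega)
    refine P.cls_top (i := i) (lo := 2 * (P.x i - 1)) (hi := 2 * (P.x i + P.y i))
        (Or.inl rfl) (Or.inl rfl) (by omega) (by omega) (Or.inr (Or.inl (by omega))) 
        (P.psx (by omega)) P.psC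
  | c4 i i' k hi e hk =>
    subst e hk
    have := P.n_lt (i := i) (by omega)
    refine P.cls_bot (i := i) (lo := 2 * (P.x i + P.y i)) (hi := P.BB + 2 * P.x (i+1))
          (Or.inl rfl) (Or.inr rfl) (by omega) (by omega) (Or.inr (Or.inl (by omega))) P.psC ?_
    rw [P.psy (by omega), add_mul]; omega
  | c5 i i' j k hi e hj hk =>
    subst e hk
    have hx := P.hx i (by omega)
    have hy := P.hy i (by omega)
    have := P.n_lt (i := i) (by omega)
    refine P.cls_bot (i := i) (lo := 2 * j) (hi := P.BB + 2 * P.x (i+1))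
          (Or.inl rfl) (Or.inr rfl) (by omega) (by omega) (Or.inr (Or.inr (Or.inl (by omega))))
          (P.psy (by omega)) ?_
    rw [P.psy (by omega), add_mul]; omega
  | c6 i i' j k hi e hj hk =>
    subst e hk
    have hx := P.hx i (by omega)
    have := P.n_lt (i := i) (by omega)
    refine P.cls_top (i := i) (lo := 2 * (P.x i - 1)) (hi := P.BB)
        (Or.inr rfl) (Or.inl rfl) (by omega) (by omega) (Or.inr (Or.inl (by omega))) 
        (P.psx (by omega)) ?_
    rw [P.psx (by omega), add_mul]; omega
  | d1 i j hi hj =>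
    have := P.ha i hi
    refine P.cls_top (i := i) (lo := 2 * (P.x i - 1 - P.p i) + 1) (hi := 2 * (P.x i - 1 - j))
        (Or.inl rfl) (Or.inl rfl) (by omega) (by omega) (Or.inl (by omega)) P.psD (P.psx (by omega))
  | d2 i i' j hi e hj =>
    subst e
    have := P.ha i hi
    refine P.cls_lb (i := i) (α := 2 * (P.x i - 1 - P.p i) + 1) (β := 2 * j) rfl rfl
      ⟨hi, Or.inr ⟨id, by omega, by omega⟩⟩ P.psD (P.psy (by omega))
  | d3 i k hi hk =>
    subst hk
    have := P.ha i hi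
    refine P.cls_top (i := i) (lo := 2 * (P.x i - 1 - P.p i)) (hi := 2 * (P.x i - 1 - P.p i) + 1)
        (Or.inl rfl) (Or.inl rfl) (by omega) (by omega) (Or.inl (by omega)) (P.psx (by omega)) P.psD
  | d4 i i' k hi e hk =>
    subst e hk
    have := P.ha i hi
    refine P.cls_lf (i := i) (α := 2 * (P.x i - 1 - P.p i) + 1) (β := 2 * (P.x (i+3) + P.r (i+3)))
      rfl rfl ⟨hi, Or.inl ⟨trivial, by omega, by omega⟩⟩ P.psD (P.psy (by omega))
  | d5 i i' j k hi e hj hk =>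
    subst e hk
    have := P.ha i hi
    refine P.cls_lf (i := i) (α := 2 * (P.x i - 1 - j)) (β := 2 * (P.x (i+3) + P.r (i+3)))
      rfl rfl ⟨hi, Or.inl ⟨trivial, by omega, by omega⟩⟩ (P.psx (by omega)) (P.psy (by omega))
  | d6 i i' j k hi e hj hk =>
    subst e hk
    have := P.ha i hi
    refine P.cls_lb (i := i) (α := 2 * (P.x i - 1 - P.p i)) (β := 2 * j) rfl rfl
      ⟨hi, Or.inr ⟨id, by omega, by omega⟩⟩ (P.psx (by omega)) (P.psy (by omega))

/-- Crossing condition on natural numbers. -/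
def nc (l m l' m' : ℕ) : Prop :=
  m ≤ l' ∨ m' ≤ l ∨ (l ≤ l' ∧ m' ≤ m) ∨ (l' ≤ l ∧ m ≤ m')

theorem TI_le {i lo hi : ℕ} (hi0 : i < P.f) (h : P.TI i lo hi) : lo < hi ∧ hi ≤ P.BB := by
  have := P.n_lt hi0
  have := P.hx i hi0
  have := P.hy i hi0
  unfold TI at h
  omega

theorem TT {i lo hi i' lo' hi' : ℕ} (h0 : i < P.f) (h0' : i' < P.f) (h : P.TI i lo hi)
    (h' : P.TI i' lo' hi') :
    nc (i * P.BB + lo + 1) (i * P.BB + hi + 1) (i' * P.BB + lo' + 1) (i' * P.BB + hi' + 1) := by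
  have h1 := P.TI_le h0 h
  have h2 := P.TI_le h0' h'
  unfold nc
  rcases lt_trichotomy i i' with e | e | e
  · have := lex (B := P.BB) e; omega
  · subst e
    have := P.n_lt h0
    have := P.hx i h0
    have := P.hy i h0
    unfold TI at h h'
    omega
  · have := lex (B := P.BB) e; omega

theorem BI_le {i lo hi : ℕ} (hi0 : i < P.f) (h : P.BI i lo hi) : lo < hi ∧
    (i = 0 ∨ 2 * P.x i ≤ lo) ∧ (hi ≤ P.BB ∨ (i + 1 < P.f ∧ hi = P.BB + 2 * P.x (i+1))) := by
  have := P.n_lt hi0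
  have := P.hx i hi0
  have := P.hy i hi0
  unfold BI at h
  rcases h with h | h | h | ⟨rfl, h⟩ <;> omega

theorem BT_aux {i lo hi i' lo' hi' : ℕ} (h0 : i < P.f) (h0' : i' < P.f) (h : P.BI i lo hi)
    (h' : P.BI i' lo' hi') (e : i < i') : i * P.BB + hi + 1 ≤ i' * P.BB + lo' + 1 := by
  obtain ⟨a1, a2, a3⟩ := P.BI_le h0 h
  obtain ⟨b1, b2, b3⟩ := P.BI_le h0' h'
  have hl := lex (B := P.BB) e
  rcases Nat.lt_or_ge (i+1) i' with e' | e'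
  · have hl' := lex (B := P.BB) e'
    rw [add_mul, one_mul] at hl'
    rcases a3 with a3 | ⟨a3, a4⟩
    · omega
    · have := P.n_lt a3
      omega
  · have : i' = i + 1 := by omega
    subst this
    rw [add_mul, one_mul]
    omega

theorem BT {i lo hi i' lo' hi' : ℕ} (h0 : i < P.f) (h0' : i' < P.f) (h : P.BI i lo hi)
    (h' : P.BI i' lo' hi') :
    nc (i * P.BB + lo + 1) (i * P.BB + hi + 1) (i' * P.BB + lo' + 1) (i' * P.BB + hi' + 1) := by
  unfold nc
  rcases lt_trichotomy i i' with e | e | e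
  · have := P.BT_aux h0 h0' h h' e; omega
  · subst e
    have := P.n_lt h0
    have := P.hx i h0
    have := P.hy i h0
    have hz : i = 0 → P.x 0 = P.x i := by rintro rfl; rfl
    unfold BI at h h'
    rcases h with h | h | h | h <;> rcases h' with h' | h' | h' | h' <;> omega
  · have := P.BT_aux h0' h0 h' h e; omega

theorem TL {i lo hi i' α β : ℕ} {t : Prop} (h0 : i < P.f) (h : P.TI i lo hi)
    (h' : P.LI i' α β t) :
    i' * P.BB + α + 1 ≤ i * P.BB + lo + 1 ∨ i * P.BB + hi + 1 ≤ i' * P.BB + α + 1 := by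
  have h1 := P.TI_le h0 h
  obtain ⟨ha, h'⟩ := h'
  have hA := P.ha i' ha
  have := P.n_lt (i := i') (by omega)
  have hα : α ≤ 2 * (P.x i' - 1) ∧ (α = 2 * (P.x i' - 1 - P.p i') + 1 ∨ α % 2 = 0) := by
    rcases h' with ⟨_, h2, h3⟩ | ⟨_, h2, h3⟩ <;> omega
  clear h'
  rcases lt_trichotomy i i' with e | e | e
  · have := lex (B := P.BB) e; omega
  · subst e
    have := P.hx i h0
    have := P.hy i h0
    unfold TI at h
    rcases h with ⟨a1, a2, a3, a4, a5⟩ | h | h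
    · have := a5 ha
      omega
    · omega
    · omega
  · have := lex (B := P.BB) e; omega

theorem BL {i lo hi i' α β : ℕ} {t : Prop} (h0 : i < P.f) (h : P.BI i lo hi)
    (h' : P.LI i' α β t) :
    (i'+3) * P.BB + β + 1 ≤ i * P.BB + lo + 1 ∨ i * P.BB + hi + 1 ≤ (i'+3) * P.BB + β + 1 := by
  obtain ⟨ha, h'⟩ := h'
  have hA := P.ha i' ha
  have := P.n_lt (i := i'+3) (by omega)
  have hx := P.hx (i'+3) (by omega)
  have hβ : 2 * P.x (i'+3) ≤ β ∧ β + 2 ≤ 2 * (P.x (i'+3) + P.y (i'+3)) ∧ β % 2 = 0 := by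
    rcases h' with ⟨_, h2, h3⟩ | ⟨_, h2, h3⟩ <;> omega
  clear h'
  have hI : i' + 3 < P.f := hA.1
  have hI0 : 0 < i' + 3 := by omega
  clear hA
  generalize i' + 3 = I at *
  rcases lt_trichotomy i I with e | e | e
  · have hB : P.BI I β (β+2) := Or.inl (by omega)
    have := P.BT_aux h0 hI h hB e
    omega
  · subst e
    have := P.hy i h0
    unfold BI at h
    omega
  · have := lex (B := P.BB) e; omega

theorem LL_aux {i α β i' α' β' : ℕ} {t t' : Prop} (h : P.LI i α β t) (h' : P.LI i' α' β' t')
    (e : i < i') : i * P.BB + α < i' * P.BB + α' ∧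
      (i+3) * P.BB + β < (i'+3) * P.BB + β' := by
  obtain ⟨ha, h⟩ := h
  obtain ⟨ha', h'⟩ := h'
  have hA := P.ha i ha
  have := P.n_lt (i := i) (by omega)
  have := P.n_lt (i := i+3) (by omega)
  have h1 := lex (B := P.BB) e
  have h2 := lex (B := P.BB) (show i + 3 < i' + 3 by omega)
  have : α < P.BB ∧ β < P.BB := by
    rcases h with ⟨_, h2, h3⟩ | ⟨_, h2, h3⟩ <;> omega
  omega

theorem LL {i α β i' α' β' : ℕ} {t t' : Prop} (h : P.LI i α β t) (h' : P.LI i' α' β' t')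
    (hne : i = i' → α = α' → (t ↔ t') → False) :
    i * P.BB + α + ((i+3) * P.BB + β) ≠ i' * P.BB + α' + ((i'+3) * P.BB + β') ∧
    ((i * P.BB + α ≤ i' * P.BB + α' ∧ (i+3) * P.BB + β ≤ (i'+3) * P.BB + β') ∨
     (i' * P.BB + α' ≤ i * P.BB + α ∧ (i'+3) * P.BB + β' ≤ (i+3) * P.BB + β)) := by
  rcases lt_trichotomy i i' with e | e | e
  · have := P.LL_aux h h' e; omega
  · subst e
    have hne := hne rfl
    rcases h.2 with ⟨c1, c2, c3⟩ | ⟨c1, c2, c3⟩ <;> rcases h'.2 with ⟨d1, d2, d3⟩ | ⟨d1, d2, d3⟩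
    · have : α ≠ α' := fun e => hne e (by tauto)
      omega
    · omega
    · omega
    · have : α ≠ α' := fun e => hne e (by tauto)
      omega
  · have := P.LL_aux h' h e; omega

theorem cls_loop {u v : Vx} (h : P.Cls u v) (hk : (P.kd u v).isLoop) :
    ∃ i α β t, P.LI i α β t ∧ (t ↔ P.kd u v = Kd.lf) ∧
      (P.ps u + P.ps v = i * P.BB + α + ((i+3) * P.BB + β) + 2) ∧
      (P.kd u v).upL (P.ps u) (P.ps v) = -((P.ps u : ℤ) + P.ps v) ∧
      (P.kd u v).dnL (P.ps u) (P.ps v) = -((P.ps u : ℤ) + P.ps v) ∧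
      (P.kd u v).upR (P.ps u) (P.ps v) = (i * P.BB + α + 1 : ℕ) ∧
      (P.kd u v).dnR (P.ps u) (P.ps v) = ((i+3) * P.BB + β + 1 : ℕ) ∧
      (t → P.ps u = i * P.BB + α + 1 ∧ P.ps v = (i+3) * P.BB + β + 1) ∧
      (¬ t → P.ps v = i * P.BB + α + 1 ∧ P.ps u = (i+3) * P.BB + β + 1) := by
  rcases h with ⟨e, _⟩ | ⟨e, _⟩ | ⟨e, i, α, β, h, hu, hv⟩ | ⟨e, i, α, β, h, hu, hv⟩
  · rw [e] at hk; exact hk.elim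
  · rw [e] at hk; exact hk.elim
  · refine ⟨i, α, β, True, h, by simp [e], by omega, ?_⟩
    rw [e]
    simp only [Kd.upL, Kd.upR, Kd.dnL, Kd.dnR, hu, hv]
    simp
  · refine ⟨i, α, β, False, h, by simp [e], by omega, ?_⟩
    rw [e]
    simp only [Kd.upL, Kd.upR, Kd.dnL, Kd.dnR, hu, hv]
    simp

theorem LL' {u v u' v' : Vx} (hu : P.Valid u) (hv : P.Valid v) (hu' : P.Valid u')
    (hv' : P.Valid v') (h : P.Cls u v) (h' : P.Cls u' v') (hne : (u, v) ≠ (u', v'))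
    (hk : (P.kd u v).isLoop) (hk' : (P.kd u' v').isLoop) :
    (P.ps u : ℤ) + P.ps v ≠ P.ps u' + P.ps v' ∧
    NC ((P.kd u v).upL (P.ps u) (P.ps v)) ((P.kd u v).upR (P.ps u) (P.ps v))
        ((P.kd u' v').upL (P.ps u') (P.ps v')) ((P.kd u' v').upR (P.ps u') (P.ps v')) ∧
    NC ((P.kd u v).dnL (P.ps u) (P.ps v)) ((P.kd u v).dnR (P.ps u) (P.ps v))
        ((P.kd u' v').dnL (P.ps u') (P.ps v')) ((P.kd u' v').dnR (P.ps u') (P.ps v')) := by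
  obtain ⟨i, α, β, t, hL, a1, a2, a3, a4, a5, a6, a7, a8⟩ := P.cls_loop h hk
  obtain ⟨i', α', β', t', hL', b1, b2, b3, b4, b5, b6, b7, b8⟩ := P.cls_loop h' hk'
  obtain ⟨c1, c2⟩ := P.LL hL hL' (by
    rintro rfl rfl ht
    have hβ : β = β' := by
      rcases hL.2 with ⟨c1, c2, c3⟩ | ⟨c1, c2, c3⟩ <;>
        rcases hL'.2 with ⟨d1, d2, d3⟩ | ⟨d1, d2, d3⟩
      · omega
      · exact absurd (ht.1 c1) d1
      · exact absurd (ht.2 d1) c1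
      · omega
    subst hβ
    apply hne
    by_cases hT : t
    · have x1 := a7 hT
      have x2 := b7 (ht.1 hT)
      rw [P.ps_inj hu hu' (by omega), P.ps_inj hv hv' (by omega)]
    · have x1 := a8 hT
      have x2 := b8 (fun h => hT (ht.2 h))
      rw [P.ps_inj hu hu' (by omega), P.ps_inj hv hv' (by omega)])
  rw [a3, a4, a5, a6, b3, b4, b5, b6]
  unfold NC
  generalize i * P.BB = I at *
  generalize (i+3) * P.BB = J at *
  generalize i' * P.BB = I' at *
  generalize (i'+3) * P.BB = J' at *
  refine ⟨by omega, ⟨by omega, by omega⟩, ⟨by omega, by omega⟩⟩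

theorem nc_NC {l m l' m' : ℕ} (h : nc l m l' m') (hd : l ≠ l' ∨ m ≠ m') :
    NC (l:ℤ) m l' m' := by
  unfold nc at h
  unfold NC
  omega

theorem NC.symm {l m l' m' : ℤ} (h : NC l m l' m') : NC l' m' l m := by
  unfold NC at *
  omega

theorem cls_up {u v : Vx} (h : P.Cls u v) (hk : (P.kd u v).hasUp) :
    (P.kd u v).isLoop ∨ ∃ i lo hi, i < P.f ∧ P.TI i lo hi ∧ P.ps v = i * P.BB + lo + 1 ∧
    P.ps u = i * P.BB + hi + 1 ∧ (P.kd u v).upL (P.ps u) (P.ps v) = P.ps v ∧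
    (P.kd u v).upR (P.ps u) (P.ps v) = P.ps u := by
  rcases h with ⟨e, i, lo, hi, h1, h2, h3, h4⟩ | ⟨e, _⟩ | ⟨e, _⟩ | ⟨e, _⟩
  · have := P.TI_le h1 h2
    refine Or.inr ⟨i, lo, hi, h1, h2, h3, h4, ?_, ?_⟩
    · rw [e]; simp only [Kd.upL]; omega
    · rw [e]; simp only [Kd.upR]; omega
  · rw [e] at hk; exact hk.elim
  · rw [e]; exact Or.inl trivial
  · rw [e]; exact Or.inl trivial

theorem cls_dn {u v : Vx} (h : P.Cls u v) (hk : (P.kd u v).hasDn) :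
    (P.kd u v).isLoop ∨ ∃ i lo hi, i < P.f ∧ P.BI i lo hi ∧ P.ps u = i * P.BB + lo + 1 ∧
    P.ps v = i * P.BB + hi + 1 ∧ (P.kd u v).dnL (P.ps u) (P.ps v) = P.ps u ∧
    (P.kd u v).dnR (P.ps u) (P.ps v) = P.ps v := by
  rcases h with ⟨e, _⟩ | ⟨e, i, lo, hi, h1, h2, h3, h4⟩ | ⟨e, _⟩ | ⟨e, _⟩
  · rw [e] at hk; exact hk.elim
  · have := P.BI_le h1 h2
    refine Or.inr ⟨i, lo, hi, h1, h2, h3, h4, ?_, ?_⟩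
    · rw [e]; simp only [Kd.dnL]; omega
    · rw [e]; simp only [Kd.dnR]; omega
  · rw [e]; exact Or.inl trivial
  · rw [e]; exact Or.inl trivial

theorem TL' {u v u' v' : Vx} (h' : P.Cls u' v') (hk' : (P.kd u' v').isLoop) {i lo hi : ℕ}
    (h0 : i < P.f) (h1 : P.TI i lo hi) (h2 : P.ps v = i * P.BB + lo + 1)
    (h3 : P.ps u = i * P.BB + hi + 1) :
    NC (P.ps v) (P.ps u)
      ((P.kd u' v').upL (P.ps u') (P.ps v')) ((P.kd u' v').upR (P.ps u') (P.ps v')) := by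
  obtain ⟨i', α', β', t', hL', b1, b2, b3, b4, b5, b6, b7, b8⟩ := P.cls_loop h' hk'
  have := P.TL h0 h1 hL'
  have := P.TI_le h0 h1
  rw [b3, b5]
  unfold NC
  generalize i * P.BB = I at *
  generalize i' * P.BB = I' at *
  generalize (i'+3) * P.BB = J' at *
  constructor <;> omega

theorem BL' {u v u' v' : Vx} (h' : P.Cls u' v') (hk' : (P.kd u' v').isLoop) {i lo hi : ℕ}
    (h0 : i < P.f) (h1 : P.BI i lo hi) (h2 : P.ps u = i * P.BB + lo + 1)
    (h3 : P.ps v = i * P.BB + hi + 1) :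
    NC (P.ps u) (P.ps v)
      ((P.kd u' v').dnL (P.ps u') (P.ps v')) ((P.kd u' v').dnR (P.ps u') (P.ps v')) := by
  obtain ⟨i', α', β', t', hL', b1, b2, b3, b4, b5, b6, b7, b8⟩ := P.cls_loop h' hk'
  have := P.BL h0 h1 hL'
  have := P.BI_le h0 h1
  rw [b4, b6]
  unfold NC
  generalize i * P.BB = I at *
  generalize i' * P.BB = I' at *
  generalize (i'+3) * P.BB = J' at *
  constructor <;> omega

theorem dist {u v u' v' : Vx} (hu : P.Valid u) (hv : P.Valid v) (hu' : P.Valid u')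
    (hv' : P.Valid v') (hne : (u, v) ≠ (u', v')) : P.ps u ≠ P.ps u' ∨ P.ps v ≠ P.ps v' := by
  by_contra hc
  push Not at hc
  exact hne (by rw [P.ps_inj hu hu' hc.1, P.ps_inj hv hv' hc.2])

theorem planar : P.H.IsPlanar := by
  have val : ∀ u : P.H.V, P.Valid u.1 := fun u => (P.mem_vs _).1 u.2
  have ne : ∀ {u v u' v' : P.H.V}, (u, v) ≠ (u', v') → (u.1, v.1) ≠ (u'.1, v'.1) := by
    intro u v u' v' h e
    rw [Prod.mk.injEq] at e
    exact h (by rw [Subtype.ext e.1, Subtype.ext e.2])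
  have cl : ∀ {u v : P.H.V}, P.H.Adj u v → P.Cls u.1 v.1 := fun h => P.cls (P.arc_E h)
  refine planar_of P.H (fun v => (P.ps v.1 : ℤ)) (fun u v => P.kd u.1 v.1) ?_ ?_ ?_ ?_ ?_ ?_
  · intro v
    simp only [ps]
    omega
  · intro u v h
    exact Subtype.ext (P.ps_inj (val u) (val v) (Int.ofNat_inj.1 h))
  · rintro u v h rfl
    rcases cl h with ⟨e, i, lo, hi, h1, h2, h3, h4⟩ | ⟨e, i, lo, hi, h1, h2, h3, h4⟩ | ⟨e, _⟩ | ⟨e, _⟩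
    · have := P.TI_le h1 h2; omega
    · have := P.BI_le h1 h2; omega
    · unfold kd at e
      rw [if_neg (by omega), if_neg (by omega), if_neg (by omega)] at e
      cases e
    · unfold kd at e
      rw [if_neg (by omega), if_neg (by omega), if_neg (by omega)] at e
      cases e
  · intro u v u' v' h h' hne hk hk'
    have D := P.dist (val u) (val v) (val u') (val v') (ne hne)
    rcases P.cls_up (cl h) hk with l | ⟨i, lo, hi, h0, h1, h2, h3, h4, h5⟩ <;>
      rcases P.cls_up (cl h') hk' with l' | ⟨i', lo', hi', h0', h1', h2', h3', h4', h5'⟩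
    · exact (P.LL' (val u) (val v) (val u') (val v') (cl h) (cl h') (ne hne) l l').2.1
    · rw [h4', h5']
      exact NC.symm (P.TL' (cl h) l h0' h1' h2' h3')
    · rw [h4, h5]
      exact P.TL' (cl h') l' h0 h1 h2 h3
    · rw [h4', h5', h4, h5]
      apply nc_NC
      · rw [h2, h3, h2', h3']
        exact P.TT h0 h0' h1 h1'
      · exact D.symm
  · intro u v u' v' h h' hne hk hk'
    have D := P.dist (val u) (val v) (val u') (val v') (ne hne)
    rcases P.cls_dn (cl h) hk with l | ⟨i, lo, hi, h0, h1, h2, h3, h4, h5⟩ <;>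
      rcases P.cls_dn (cl h') hk' with l' | ⟨i', lo', hi', h0', h1', h2', h3', h4', h5'⟩
    · exact (P.LL' (val u) (val v) (val u') (val v') (cl h) (cl h') (ne hne) l l').2.2
    · rw [h4', h5']
      exact NC.symm (P.BL' (cl h) l h0' h1' h2' h3')
    · rw [h4, h5]
      exact P.BL' (cl h') l' h0 h1 h2 h3
    · rw [h4', h5', h4, h5]
      apply nc_NC
      · rw [h2, h3, h2', h3']
        exact P.BT h0 h0' h1 h1'
      · exact D
  · intro u v u' v' h h' hne hk hk'
    exact (P.LL' (val u) (val v) (val u') (val v') (cl h) (cl h') (ne hne) hk hk').1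

end Par

namespace Par

theorem card_eq (P : Par) : P.vs.card + (P.f - 1) + ∑ i ∈ Finset.range P.f, P.a i = P.f * P.g := by
  have hf := P.hf
  have h1 : ((Finset.range P.f).filter (fun i => P.a i = 1)).card =
      ∑ i ∈ Finset.range P.f, P.a i := by
    rw [Finset.card_filter]
    apply Finset.sum_congr rfl
    intro i _
    have := P.ha1 i
    split_ifs <;> omega
  have h2 : ∑ i ∈ Finset.range P.f, (P.x i + P.y i + (if i + 1 < P.f then 1 else 0) +
      (if 0 < i then 1 else 0) + P.a i + (if 3 ≤ i then P.a (i-3) else 0)) = P.f * P.g := by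
    rw [Finset.sum_congr rfl (fun i hi => P.hdeg i (Finset.mem_range.1 hi))]
    simp
  simp only [Finset.sum_add_distrib (s := Finset.range P.f)] at h2
  have h3 : ∑ i ∈ Finset.range P.f, (if i + 1 < P.f then 1 else 0) = P.f - 1 := by
    obtain ⟨F, hF⟩ : ∃ F, P.f = F + 1 := ⟨P.f - 1, by omega⟩
    rw [hF, Finset.sum_range_succ, if_neg (by omega),
      Finset.sum_congr rfl (fun i hi => if_pos (by have := Finset.mem_range.1 hi; omega))]
    simp
  have h4 : ∑ i ∈ Finset.range P.f, (if 0 < i then 1 else 0) = P.f - 1 := by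
    obtain ⟨F, hF⟩ : ∃ F, P.f = F + 1 := ⟨P.f - 1, by omega⟩
    rw [hF, Finset.sum_range_succ', if_neg (by omega),
      Finset.sum_congr rfl (fun i hi => if_pos (by omega))]
    simp
  have h5 : ∑ i ∈ Finset.range P.f, (if 3 ≤ i then P.a (i-3) else 0) =
      ∑ i ∈ Finset.range P.f, P.a i := by
    obtain ⟨F, hF⟩ : ∃ F, P.f = F + 3 := ⟨P.f - 3, by omega⟩
    have z : ∀ i, F ≤ i → P.a i = 0 := by
      intro i hi
      by_contra hc
      have := P.ha i (by have := P.ha1 i; omega)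
      omega
    rw [hF]
    rw [Finset.sum_range_succ P.a, Finset.sum_range_succ P.a, Finset.sum_range_succ P.a,
      z _ (by omega), z _ (by omega), z _ (by omega), Finset.sum_range_succ',
      Finset.sum_range_succ', Finset.sum_range_succ', if_neg (by omega), if_neg (by omega),
      if_neg (by omega)]
    simp
  have h6 := P.card_vs
  rw [Finset.sum_add_distrib] at h6
  omega

end Par

/-- A periodic pattern. -/
structure Pat where
  Q : ℕ
  g0 : ℕ
  A : List ℕ
  p : List ℕ
  r : List ℕ
  y : List ℕ

namespace Pat
variable (R : Pat)

def At (i : ℕ) : ℕ := R.A.getD (i % R.Q) 0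
def pt (i : ℕ) : ℕ := R.p.getD (i % R.Q) 0
def rt (i : ℕ) : ℕ := R.r.getD (i % R.Q) 0
def yt (i : ℕ) : ℕ := R.y.getD (i % R.Q) 0
def Bt (i : ℕ) : ℕ := R.At (i + (3 * R.Q - 3))
def Xt (i : ℕ) : ℕ := R.g0 - (R.yt i + 2 + R.At i + R.Bt i)
def Lt (i : ℕ) : ℕ := if R.At i = 1 then R.pt i else R.Xt i
def Pt (i : ℕ) : ℕ := if R.At i = 1 then R.pt i else 0

/-- Conditions on a pattern at an index. -/
def chk (i : ℕ) : Prop :=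
  (R.At i ≤ 1 ∧ R.Bt (i+3) = R.At i ∧ 1 ≤ R.yt i ∧
    R.yt i + 2 + R.At i + R.Bt i + 1 ≤ R.g0) ∧
  (R.At i = 1 → 1 ≤ R.pt i ∧ R.pt i < R.Xt i ∧ 1 ≤ R.rt (i+3) ∧ R.rt (i+3) < R.yt (i+3) ∧
    R.pt i ≤ 3 ∧ R.pt i + 2 ≤ R.yt (i+1) + R.yt (i+2) + R.rt (i+3) ∧
    (R.At (i+1) = 1 ∨ R.At (i+2) = 1)) ∧
  (R.At i = 1 → R.At (i+1) = 1 → R.g0 + R.pt (i+1) + R.rt (i+3) ≤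
    R.pt i + R.Xt (i+1) + R.yt (i+3) + R.rt (i+4) ∧ R.rt (i+4) ≤ 4) ∧
  (R.At i = 1 → R.At (i+1) = 0 → R.At (i+2) = 1 → R.g0 + R.pt (i+2) + R.rt (i+3) ≤
      R.pt i + R.Xt (i+1) + R.Xt (i+2) + R.yt (i+3) + R.yt (i+4) + R.rt (i+5) ∧
    R.rt (i+5) ≤ 4 ∧ R.yt (i+4) + R.Pt (i+5) ≤ 2 + R.Lt (i+3) + R.Xt (i+5) ∧
    R.yt (i+4) + R.rt (i+5) ≤ 2 + R.Lt (i+3) + R.pt (i+2) + R.At (i+3))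

instance (i : ℕ) : Decidable (R.chk i) := by
  unfold chk
  refine @instDecidableAnd _ _ ?_ (@instDecidableAnd _ _ ?_ (@instDecidableAnd _ _ ?_ ?_)) <;>
    infer_instance

theorem At_mod (i k : ℕ) : R.At (i % R.Q + k) = R.At (i + k) := by
  unfold At; rw [Nat.mod_add_mod]
theorem pt_mod (i k : ℕ) : R.pt (i % R.Q + k) = R.pt (i + k) := by
  unfold pt; rw [Nat.mod_add_mod]
theorem rt_mod (i k : ℕ) : R.rt (i % R.Q + k) = R.rt (i + k) := by
  unfold rt; rw [Nat.mod_add_mod]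
theorem yt_mod (i k : ℕ) : R.yt (i % R.Q + k) = R.yt (i + k) := by
  unfold yt; rw [Nat.mod_add_mod]
theorem Bt_mod (i k : ℕ) : R.Bt (i % R.Q + k) = R.Bt (i + k) := by
  unfold Bt; rw [add_assoc, At_mod, add_assoc]
theorem Xt_mod (i k : ℕ) : R.Xt (i % R.Q + k) = R.Xt (i + k) := by
  unfold Xt; rw [yt_mod, At_mod, Bt_mod]
theorem Lt_mod (i k : ℕ) : R.Lt (i % R.Q + k) = R.Lt (i + k) := by
  unfold Lt; rw [At_mod, pt_mod, Xt_mod]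
theorem Pt_mod (i k : ℕ) : R.Pt (i % R.Q + k) = R.Pt (i + k) := by
  unfold Pt; rw [At_mod, pt_mod]

theorem chk_mod (i : ℕ) (h : R.chk (i % R.Q)) : R.chk i := by
  unfold chk at *
  have a0 := R.At_mod i 0
  have p0 := R.pt_mod i 0
  have y0 := R.yt_mod i 0
  have B0 := R.Bt_mod i 0
  have X0 := R.Xt_mod i 0
  simp only [add_zero] at a0 p0 y0 B0 X0
  simpa only [At_mod, pt_mod, rt_mod, yt_mod, Bt_mod, Xt_mod, Lt_mod, Pt_mod, a0, p0, y0, B0, X0]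
    using h

/-- A valid pattern. -/
structure Ok (c : ℕ) : Prop where
  hQ : 0 < R.Q
  h0 : R.At 0 = 1
  ck : ∀ k, k < R.Q → R.chk k
  l : R.rt 3 + 1 ≤ R.pt 0 + R.Xt 1
  hc : ∑ i ∈ Finset.range R.Q, R.At i = c

variable {R} {c : ℕ}

theorem Ok.all (K : R.Ok c) (i : ℕ) : R.chk i :=
  R.chk_mod i (K.ck _ (Nat.mod_lt _ K.hQ))

variable (R)
def aa (s i : ℕ) : ℕ := if i ≤ R.Q * s then R.At i else 0
def bb (s i : ℕ) : ℕ := if 3 ≤ i then R.aa s (i-3) else 0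
def dg (s i : ℕ) : ℕ := (if i + 1 < R.Q * s + 4 then 1 else 0) + (if 0 < i then 1 else 0) +
  R.aa s i + R.bb s i
def xx (g s i : ℕ) : ℕ := g - (R.yt i + R.dg s i)

variable {R}

theorem aa_le (_ : R.Ok c) (s i : ℕ) : R.aa s i ≤ R.At i := by
  unfold aa; split_ifs <;> omega

theorem bb_le (K : R.Ok c) (s i : ℕ) : R.bb s i ≤ R.Bt i := by
  unfold bb
  split_ifs with h
  · obtain ⟨j, rfl⟩ : ∃ j, i = j + 3 := ⟨i - 3, by omega⟩
    rw [(K.all j).1.2.1, Nat.add_sub_cancel]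
    exact aa_le K s j
  · omega

theorem dg_le (K : R.Ok c) (s i : ℕ) : R.dg s i ≤ 2 + R.At i + R.Bt i := by
  have := aa_le K s i
  have := bb_le K s i
  unfold dg
  split_ifs <;> omega

theorem xx_ge (K : R.Ok c) {g : ℕ} (hg : R.g0 ≤ g) (s i : ℕ) :
    R.Xt i + (g - R.g0) ≤ R.xx g s i ∧ 1 ≤ R.Xt i ∧ R.xx g s i + R.yt i + R.dg s i = g := by
  have := dg_le K s i
  have := (K.all i).1.2.2.2
  unfold xx Xt
  omega

theorem aa_one {s i : ℕ} (h : R.aa s i = 1) : i ≤ R.Q * s ∧ R.At i = 1 := by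
  unfold aa at h
  split_ifs at h with h2
  exact ⟨h2, h⟩

/-- The parameters obtained from a pattern. -/
def par (K : R.Ok c) {g : ℕ} (hg : R.g0 ≤ g) (s : ℕ) : Par where
  f := R.Q * s + 4
  g := g
  x := R.xx g s
  y := R.yt
  p := R.pt
  r := R.rt
  a := R.aa s
  hf := by omega
  hx i _ := by have := xx_ge K hg s i; omega
  hy i _ := (K.all i).1.2.2.1
  ha1 i := (aa_le K s i).trans (K.all i).1.1
  ha i h := by
    obtain ⟨h1, h2⟩ := aa_one h
    have := xx_ge K hg s i
    have := (K.all i).2.1 h2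
    refine ⟨?_, ?_, ?_, ?_, ?_⟩ <;> omega
  hdeg i _ := by
    have := (xx_ge K hg s i).2.2
    unfold dg bb at this
    omega

theorem Lx_ge (K : R.Ok c) {g : ℕ} (hg : R.g0 ≤ g) (s i : ℕ) :
    R.Lt i ≤ (par K hg s).lx i ∧ R.Lt i + R.At i ≤ (par K hg s).lx i + (par K hg s).a i := by
  have h1 := xx_ge K hg s i
  have h2 := (K.all i).2.1
  have h3 := (K.all i).1.1
  show R.Lt i ≤ (if R.aa s i = 1 then R.pt i else R.xx g s i) ∧
    R.Lt i + R.At i ≤ (if R.aa s i = 1 then R.pt i else R.xx g s i) + R.aa s i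
  unfold Lt
  by_cases ha : R.aa s i = 1
  · have := (aa_one ha).2
    rw [if_pos ha, if_pos this]
    omega
  · rw [if_neg ha]
    split_ifs with h
    · have := h2 h; omega
    · omega

theorem Pp_le (K : R.Ok c) {g : ℕ} (hg : R.g0 ≤ g) (s i : ℕ) : (par K hg s).pp i ≤ R.Pt i := by
  show (if R.aa s i = 1 then R.pt i else 0) ≤ _
  unfold Pt
  split_ifs with h h'
  · exact le_rfl
  · exact (h' (aa_one h).2).elim
  · omega
  · omega

theorem At_per (s j : ℕ) : R.At (R.Q * s + j) = R.At j := by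
  unfold At; rw [Nat.mul_add_mod]

theorem good (K : R.Ok c) {g : ℕ} (hg : R.g0 ≤ g) (s : ℕ) : (par K hg s).Good := by
  constructor
  · intro m h
    have := (K.all m).2.1 (aa_one h).2
    exact ⟨this.2.2.2.2.1, this.2.2.2.2.2.1⟩
  · intro m h
    obtain ⟨h1, h2⟩ := aa_one h
    have h3 := ((K.all m).2.1 h2).2.2.2.2.2.2
    show R.aa s (m+1) = 1 ∨ R.aa s (m+2) = 1 ∨ m + 4 = R.Q * s + 4
    unfold aa
    by_cases e : m = R.Q * s
    · right; right; omega
    by_cases e' : m + 1 = R.Q * s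
    · left
      rw [if_pos (by omega), e']
      have := At_per (R := R) s 0
      rw [add_zero] at this
      rw [this, K.h0]
    · rw [if_pos (by omega), if_pos (by omega)]
      tauto
  · intro m h h'
    have := (K.all m).2.2.1 (aa_one h).2 (aa_one h').2
    have x1 := xx_ge K hg s (m+1)
    show g + R.pt (m+1) + R.rt (m+3) ≤ R.pt m + R.xx g s (m+1) + R.yt (m+3) + R.rt (m+4) ∧
      R.rt (m+4) ≤ 4
    omega
  · intro m h h1 h2
    have hA1 : R.At (m+1) = 0 := by
      have := (aa_one h2).1
      have h1 : R.aa s (m+1) = 0 := h1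
      unfold aa at h1
      rwa [if_pos (by omega)] at h1
    have := (K.all m).2.2.2 (aa_one h).2 hA1 (aa_one h2).2
    have x1 := xx_ge K hg s (m+1)
    have x2 := xx_ge K hg s (m+2)
    have x5 := xx_ge K hg s (m+5)
    have l3 := Lx_ge K hg s (m+3)
    have p5 := Pp_le K hg s (m+5)
    show g + R.pt (m+2) + R.rt (m+3) ≤
      R.pt m + R.xx g s (m+1) + R.xx g s (m+2) + R.yt (m+3) + R.yt (m+4) + R.rt (m+5) ∧
      R.rt (m+5) ≤ 4 ∧ 
      R.yt (m+4) + (par K hg s).pp (m+5) ≤ 2 + (par K hg s).lx (m+3) + R.xx g s (m+5) ∧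
      R.yt (m+4) + R.rt (m+5) ≤ 2 + (par K hg s).lx (m+3) + R.pt (m+2) + (par K hg s).a (m+3)
    omega
  · intro m h h'
    have hm : m = R.Q * s := by
      have : m + 4 = R.Q * s + 4 := h'
      omega
    have x1 := xx_ge K hg s (m+1)
    have l := K.l
    show R.rt (m+3) + 1 ≤ R.pt m + R.xx g s (m+1)
    have e1 : R.rt (m+3) = R.rt 3 := by rw [hm]; unfold rt; rw [Nat.mul_add_mod]
    have e2 : R.pt m = R.pt 0 := by
      rw [hm]; unfold pt; rw [Nat.mul_mod_right, Nat.zero_mod]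
    have e3 : R.Xt (m+1) = R.Xt 1 := by
      have := R.Xt_mod m 1
      rw [hm, Nat.mul_mod_right] at this
      rw [hm, ← this]
    omega

theorem sum_At (K : R.Ok c) (s : ℕ) : ∑ i ∈ Finset.range (R.Q * s), R.At i = c * s := by
  induction s with
  | zero => simp
  | succ s ih =>
    rw [Nat.mul_succ, Finset.sum_range_add, ih, Nat.mul_succ,
      Finset.sum_congr rfl (fun j _ => At_per (R := R) s j), K.hc]

theorem sum_aa (K : R.Ok c) (s : ℕ) : ∑ i ∈ Finset.range (R.Q * s + 4), R.aa s i = c * s + 1 := by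
  have z : ∀ i, R.Q * s < i → R.aa s i = 0 := by
    intro i hi; unfold aa; rw [if_neg (by omega)]
  rw [Finset.sum_range_succ, Finset.sum_range_succ, Finset.sum_range_succ, Finset.sum_range_succ,
    z (R.Q * s + 3) (by omega), z (R.Q * s + 2) (by omega), z (R.Q * s + 1) (by omega)]
  have h1 : ∑ i ∈ Finset.range (R.Q * s), R.aa s i = ∑ i ∈ Finset.range (R.Q * s), R.At i := by
    apply Finset.sum_congr rfl
    intro i hi
    have := Finset.mem_range.1 hi
    unfold aa
    rw [if_pos (by omega)]
  have h2 : R.aa s (R.Q * s) = 1 := by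
    unfold aa
    rw [if_pos le_rfl]
    have := At_per (R := R) s 0
    rw [add_zero] at this
    rw [this, K.h0]
  rw [h1, sum_At K, h2]

theorem main (K : R.Ok c) {g : ℕ} (hg : R.g0 ≤ g) (N : ℕ) : ∃ (s : ℕ) (H : Digr), H.IsPlanar ∧
    H.HasDigirth g ∧ N ≤ Nat.card H.V ∧ H.fvs = R.Q * s + 4 ∧
    Nat.card H.V + (R.Q * s + 3) + (c * s + 1) = (R.Q * s + 4) * g := by
  have hcard : Nat.card (par K hg N).H.V = (par K hg N).vs.card := by
    show Nat.card {v // v ∈ (par K hg N).vs} = _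
    rw [Nat.card_eq_fintype_card, Fintype.card_coe]
  have h1 := (par K hg N).card_eq
  have h2 := (par K hg N).card_vs
  have hs : ∑ i ∈ Finset.range (par K hg N).f, (par K hg N).a i = c * N + 1 := sum_aa K N
  have hf : (par K hg N).f = R.Q * N + 4 := rfl
  have hge : (par K hg N).g = g := rfl
  have hQ : N ≤ R.Q * N := Nat.le_mul_of_pos_left _ K.hQ
  refine ⟨N, (par K hg N).H, (par K hg N).planar, (par K hg N).hasDigirth (good K hg N), ?_,
    (par K hg N).fvs_eq, ?_⟩
  · rw [hcard]; omega
  · rw [hcard]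
    rw [hs, hf, hge] at h1
    omega

/-- The final computation. -/
theorem fin (K : R.Ok c) {g : ℕ} (hg : R.g0 ≤ g) (hg3 : 3 ≤ g) (κ ρ : ℝ) (hρ : ρ < 3)
    (h1 : R.Q * ρ = R.Q + c) (h2 : κ = 4 * ρ - 4) (N : ℕ) : ∃ H : Digr, H.IsPlanar ∧
    H.HasDigirth g ∧ N ≤ Nat.card H.V ∧ 
    (H.fvs : ℝ) = ((Nat.card H.V : ℝ) - κ) / ((g : ℝ) - ρ) := by
  obtain ⟨s, H, a1, a2, a3, a4, a5⟩ := main K hg N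
  refine ⟨H, a1, a2, a3, ?_⟩
  have hgr : (3:ℝ) ≤ g := by exact_mod_cast hg3
  rw [eq_div_iff (by linarith), a4]
  have a5' : (Nat.card H.V : ℝ) + (R.Q * s + 3) + (c * s + 1) = (R.Q * s + 4) * g := by
    exact_mod_cast a5
  push_cast
  linear_combination -a5' - s * h1 + h2

end Pat

def pat1 : Pat := ⟨2, 6, [1,0], [1,1], [1,1], [1,2]⟩
def pat2 : Pat := ⟨5, 8, [1,1,0,1,0], [3,1,1,1,1], [1,1,1,1,3], [1,2,3,2,4]⟩
def pat3 : Pat := ⟨11, 9, [1,1,1,0,1,0,1,1,0,1,0], [1,1,1,1,1,1,2,1,1,1,1],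
  [1,1,1,1,2,3,1,1,1,1,3], [2,2,1,5,3,5,3,2,4,3,4]⟩
def pat4 : Pat := ⟨6, 10, [1,1,1,0,1,0], [1,1,1,1,1,1], [1,1,1,1,3,3], [5,4,1,6,4,4]⟩
def pat5 : Pat := ⟨13, 11, [1,1,1,0,1,1,0,1,1,1,0,1,0], [1,1,1,1,1,1,1,1,1,1,1,1,1],
  [1,1,1,1,2,1,1,1,4,1,1,3,3], [6,4,1,7,5,4,4,5,5,2,7,5,4]⟩

theorem ok1 : pat1.Ok 1 := ⟨by decide, by decide, by decide, by decide, by decide⟩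
theorem ok2 : pat2.Ok 3 := ⟨by decide, by decide, by decide, by decide, by decide⟩
theorem ok3 : pat3.Ok 7 := ⟨by decide, by decide, by decide, by decide, by decide⟩
theorem ok4 : pat4.Ok 4 := ⟨by decide, by decide, by decide, by decide, by decide⟩
theorem ok5 : pat5.Ok 9 := ⟨by decide, by decide, by decide, by decide, by decide⟩

/-- For each threshold/formula pair below and every `g` at least the threshold,
there is an infinite family (one member with at least `N` vertices for every
`N`) of planar digraphs `H` of digirth `g` with `n` vertices satisfying:
(i) `g ≥ 6`:  `fvs(H) = (n − 2)/(g − 3/2)`;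
(ii) `g ≥ 8`:  `fvs(H) = (n − 12/5)/(g − 8/5)`;
(iii) `g ≥ 9`:  `fvs(H) = (n − 28/11)/(g − 18/11)`;
(iv) `g ≥ 10`: `fvs(H) = (n − 8/3)/(g − 5/3)`;
(v) `g ≥ 11`: `fvs(H) = (n − 36/13)/(g − 22/13)`. -/
theorem general_lower_bound_small_digirth :
    (∀ g : ℕ, 6 ≤ g → ∀ N : ℕ, ∃ H : Digr, H.IsPlanar ∧ H.HasDigirth g ∧
      N ≤ Nat.card H.V ∧
      (H.fvs : ℝ) = ((Nat.card H.V : ℝ) - 2) / ((g : ℝ) - 3 / 2)) ∧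
    (∀ g : ℕ, 8 ≤ g → ∀ N : ℕ, ∃ H : Digr, H.IsPlanar ∧ H.HasDigirth g ∧
      N ≤ Nat.card H.V ∧
      (H.fvs : ℝ) = ((Nat.card H.V : ℝ) - 12 / 5) / ((g : ℝ) - 8 / 5)) ∧
    (∀ g : ℕ, 9 ≤ g → ∀ N : ℕ, ∃ H : Digr, H.IsPlanar ∧ H.HasDigirth g ∧
      N ≤ Nat.card H.V ∧
      (H.fvs : ℝ) = ((Nat.card H.V : ℝ) - 28 / 11) / ((g : ℝ) - 18 / 11)) ∧
    (∀ g : ℕ, 10 ≤ g → ∀ N : ℕ, ∃ H : Digr, H.IsPlanar ∧ H.HasDigirth g ∧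
      N ≤ Nat.card H.V ∧
      (H.fvs : ℝ) = ((Nat.card H.V : ℝ) - 8 / 3) / ((g : ℝ) - 5 / 3)) ∧
    (∀ g : ℕ, 11 ≤ g → ∀ N : ℕ, ∃ H : Digr, H.IsPlanar ∧ H.HasDigirth g ∧
      N ≤ Nat.card H.V ∧
      (H.fvs : ℝ) = ((Nat.card H.V : ℝ) - 36 / 13) / ((g : ℝ) - 22 / 13)) := by
  refine ⟨?_, ?_, ?_, ?_, ?_⟩
  · intro g hg N
    exact Pat.fin ok1 (g := g) hg (by omega) 2 (3/2) (by norm_num)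
      (by norm_num [pat1]) (by norm_num) N
  · intro g hg N
    exact Pat.fin ok2 (g := g) hg (by omega) (12/5) (8/5) (by norm_num)
      (by norm_num [pat2]) (by norm_num) N
  · intro g hg N
    exact Pat.fin ok3 (g := g) hg (by omega) (28/11) (18/11) (by norm_num)
      (by norm_num [pat3]) (by norm_num) N
  · intro g hg N
    exact Pat.fin ok4 (g := g) hg (by omega) (8/3) (5/3) (by norm_num)
      (by norm_num [pat4]) (by norm_num) N
  · intro g hg N
    exact Pat.fin ok5 (g := g) hg (by omega) (36/13) (22/13) (by norm_num)
      (by norm_num [pat5]) (by norm_num) N
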